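/- Let G1 and G2 be finite groups with G1 abelian. If the independence complexes Σ(G1) and Σ(G2) are isomorphic, then the strong independence complexes Σ̃(G1) and Σ̃(G2) are isomorphic. -/

import Mathlib

/-- A subset `X` of a group is independent if no element of `X` lies in the
subgroup generated by the other elements of `X`. -/
def Independent {G : Type*} [Group G] (X : Set G) : Prop :=
  ∀ x ∈ X, x ∉ Subgroup.closure (X \ {x})

/-- `dgen H` is the least cardinality of a generating set of the subgroup `H`. -/
noncomputable def dgen {G : Type*} [Group G] (H : Subgroup G) : ℕ :=
  sInf {n : ℕ | ∃ S : Set G, S.Finite ∧ S ⊆ (H : Set G) ∧ Subgroup.closure S = H ∧ S.ncard = n}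

/-- A subset `X` of a group is strongly independent if every subgroup `H` containing `X`
satisfies `|X| ≤ d(H)`. -/
def StronglyIndependent {G : Type*} [Group G] (X : Set G) : Prop :=
  ∀ H : Subgroup G, X ⊆ (H : Set G) → X.ncard ≤ dgen H

/-- A group is hamiltonian if it is nonabelian and all of its subgroups are normal. -/
def IsHamiltonian (G : Type*) [Group G] : Prop :=
  (∃ a b : G, a * b ≠ b * a) ∧ ∀ H : Subgroup G, H.Normal

open Subgroup

section PowerGraph

variable {G H : Type*} [Group G] [Group H]

theorem mem_zpowers_of_orderOf_dvd [Finite G] {g x y : G} (hx : x ∈ zpowers g)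
    (hy : y ∈ zpowers g) (h : orderOf x ∣ orderOf y) : x ∈ zpowers y := by
  obtain ⟨a, rfl⟩ := mem_powers_iff_mem_zpowers.2 hx
  obtain ⟨b, rfl⟩ := mem_powers_iff_mem_zpowers.2 hy
  have hpos := orderOf_pos (g ^ b)
  have h1 : orderOf g ∣ a * orderOf (g ^ b) := by
    rw [orderOf_dvd_iff_pow_eq_one, pow_mul]
    exact orderOf_dvd_iff_pow_eq_one.1 h
  have h2 : (orderOf g).gcd b * orderOf (g ^ b) = orderOf g := by
    rw [orderOf_pow, Nat.mul_div_cancel' (Nat.gcd_dvd_left _ _)]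
  have h3 : (orderOf g).gcd b ∣ a := by
    rw [← h2] at h1
    exact Nat.dvd_of_mul_dvd_mul_right hpos (by simpa [h2] using h1)
  obtain ⟨c, rfl⟩ := h3
  change g ^ _ ∈ _
  rw [pow_mul]
  refine pow_mem ?_ c
  refine mem_zpowers_iff.2 ⟨Nat.gcdB (orderOf g) b, ?_⟩
  rw [← zpow_natCast g ((orderOf g).gcd b), Nat.gcd_eq_gcd_ab, zpow_add, zpow_mul, zpow_mul]
  simp

/-- Adjacency in the (reflexive) power graph. -/
def PowAdj (x y : G) : Prop := x ∈ zpowers y ∨ y ∈ zpowers x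

/-- `PowDom y x` says that every neighbour of `x` in the power graph is a neighbour of `y`. -/
def PowDom (y x : G) : Prop := ∀ w, PowAdj x w → PowAdj y w

/-- Two elements are twins if they have the same closed neighbourhood in the power graph. -/
def PowTwin (x y : G) : Prop := PowDom x y ∧ PowDom y x

theorem PowAdj.refl (x : G) : PowAdj x x := Or.inl (mem_zpowers x)

theorem PowAdj.symm {x y : G} (h : PowAdj x y) : PowAdj y x := Or.symm h

theorem PowDom.adj {x y : G} (h : PowDom y x) : PowAdj y x := h x (.refl x)

theorem PowDom.trans {x y z : G} (h : PowDom x y) (h' : PowDom y z) : PowDom x z :=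
  fun w hw => h w (h' w hw)

theorem PowTwin.symm {x y : G} (h : PowTwin x y) : PowTwin y x := ⟨h.2, h.1⟩

theorem PowTwin.trans {x y z : G} (h : PowTwin x y) (h' : PowTwin y z) : PowTwin x z :=
  ⟨h.1.trans h'.1, h'.2.trans h.2⟩

theorem mem_zpowers_trans {x y z : G} (h : x ∈ zpowers y) (h' : y ∈ zpowers z) :
    x ∈ zpowers z := (zpowers_le.2 h') h

theorem PowTwin.of_zpowers_eq {x y : G} (h : zpowers x = zpowers y) : PowTwin x y := by
  have key : ∀ {x y : G}, zpowers x = zpowers y → PowDom x y := by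
    intro x y h w hw
    rcases hw with hw | hw
    · exact Or.inl ((h.le (mem_zpowers x)) |> fun h1 => mem_zpowers_trans h1 hw)
    · exact Or.inr (h ▸ hw)
  exact ⟨key h, key h.symm⟩

theorem zpowers_eq_of_mem {x y : G} (h : x ∈ zpowers y) (h' : y ∈ zpowers x) :
    zpowers x = zpowers y := le_antisymm (zpowers_le.2 h) (zpowers_le.2 h')

theorem orderOf_dvd_of_mem {x y : G} (h : x ∈ zpowers y) : orderOf x ∣ orderOf y :=
  orderOf_dvd_of_mem_zpowers h

theorem mem_zpowers_of_orderOf_le [Finite G] {x y : G} (h : y ∈ zpowers x)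
    (ho : orderOf x ≤ orderOf y) : x ∈ zpowers y :=
  mem_zpowers_of_orderOf_dvd (mem_zpowers x) h
    (by rw [le_antisymm ho (Nat.le_of_dvd (orderOf_pos x) (orderOf_dvd_of_mem h))])

theorem exists_mem_zpowers_orderOf_eq [Finite G] (g : G) {d : ℕ} (hd : d ∣ orderOf g) :
    ∃ x ∈ zpowers g, orderOf x = d :=
  ⟨g ^ (orderOf g / d), pow_mem (mem_zpowers g) _, orderOf_pow_orderOf_div
    (orderOf_pos g).ne' hd⟩

theorem PowAdj.orderOf_dvd {x y : G} (h : PowAdj x y) :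
    orderOf x ∣ orderOf y ∨ orderOf y ∣ orderOf x :=
  h.imp orderOf_dvd_of_mem orderOf_dvd_of_mem

theorem powAdj_of_isPrimePow [Finite G] {g x y : G} (h : IsPrimePow (orderOf g))
    (hx : x ∈ zpowers g) (hy : y ∈ zpowers g) : PowAdj x y := by
  obtain ⟨q, k, hq, -, hk⟩ := (isPrimePow_nat_iff _).1 h
  obtain ⟨a, -, ha⟩ := (Nat.dvd_prime_pow hq).1 (hk ▸ orderOf_dvd_of_mem hx)
  obtain ⟨b, -, hb⟩ := (Nat.dvd_prime_pow hq).1 (hk ▸ orderOf_dvd_of_mem hy)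
  rcases le_total a b with hab | hab
  · exact Or.inl (mem_zpowers_of_orderOf_dvd hx hy (ha ▸ hb ▸ pow_dvd_pow q hab))
  · exact Or.inr (mem_zpowers_of_orderOf_dvd hy hx (ha ▸ hb ▸ pow_dvd_pow q hab))

theorem isPrimePow_orderOf_of_adj [Finite G] {u v : G} (hu : u ≠ 1) (huv : u ∈ zpowers v)
    (hvu : v ∉ zpowers u) (h : ∀ w ∈ zpowers v, PowAdj u w) : IsPrimePow (orderOf v) := by
  have key : ∀ d, d ∣ orderOf v → orderOf u ∣ d ∨ d ∣ orderOf u := by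
    intro d hd
    obtain ⟨x, hx, rfl⟩ := exists_mem_zpowers_orderOf_eq v hd
    exact (h x hx).orderOf_dvd
  obtain ⟨k, hk⟩ := orderOf_dvd_of_mem huv
  have hm := (orderOf_pos v).ne'
  have hk1 : k ≠ 1 := by
    rintro rfl
    exact hvu (mem_zpowers_of_orderOf_le huv (by omega))
  have hd1 : orderOf u ≠ 1 := by simpa using hu
  set q := k.minFac
  have hq : q.Prime := Nat.minFac_prime hk1
  have hqv : q ∣ orderOf v := hk ▸ (Nat.minFac_dvd k).mul_left _
  have hdq : orderOf u ∣ q ^ (orderOf v).factorization q := by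
    refine (key _ (Nat.ordProj_dvd _ _)).resolve_right fun hQ => ?_
    refine Nat.pow_succ_factorization_not_dvd hm hq ?_
    rw [pow_succ]
    conv_rhs => rw [hk]
    exact Nat.mul_dvd_mul hQ (Nat.minFac_dvd k)
  rw [isPrimePow_iff_unique_prime_dvd]
  refine ⟨q, ⟨hq, hqv⟩, fun r ⟨hr, hrv⟩ => ?_⟩
  have : r ∣ orderOf u := by
    rcases key r hrv with h1 | h1
    · rcases (Nat.dvd_prime hr).1 h1 with h2 | h2
      · exact absurd h2 hd1
      · exact h2.symm.dvd
    · exact h1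
  exact (Nat.prime_dvd_prime_iff_eq hr hq).1 (hr.dvd_of_dvd_pow (this.trans hdq))

theorem ncard_zpowers_eq [Finite G] (a : G) :
    {w : G | zpowers w = zpowers a}.ncard = (orderOf a).totient := by
  classical
  have := Fintype.ofFinite (zpowers a)
  have h := IsCyclic.card_orderOf_eq_totient (α := zpowers a) (d := orderOf a)
    (by rw [← Nat.card_eq_fintype_card, Nat.card_zpowers])
  rw [← h, ← Set.ncard_coe_finset, ← Set.ncard_image_of_injective _ Subtype.val_injective]
  congr 1
  ext w
  simp only [Set.mem_ofPred_eq, Finset.coe_filter, Finset.mem_univ, true_and, Set.mem_image,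
    Subtype.exists, exists_and_right, exists_eq_right]
  constructor
  · intro hw
    have hwa : w ∈ zpowers a := hw ▸ mem_zpowers w
    refine ⟨hwa, ?_⟩
    rw [Subgroup.orderOf_mk, ← Nat.card_zpowers, hw, Nat.card_zpowers]
  · rintro ⟨hwa, ho⟩
    rw [Subgroup.orderOf_mk] at ho
    exact zpowers_eq_of_mem hwa (mem_zpowers_of_orderOf_le hwa ho.ge)

end PowerGraph

section Transfer

variable {G H : Type*} [Group G] [Group H]

theorem card_dvd_ncard_of_mul_mem [Finite G] (K : Subgroup G) (A : Set G)
    (hA : ∀ w ∈ A, ∀ k ∈ K, w * k ∈ A) : Nat.card K ∣ A.ncard := by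
  have hpre : (QuotientGroup.mk : G → G ⧸ K) ⁻¹' (QuotientGroup.mk '' A) = A := by
    refine subset_antisymm ?_ (Set.subset_preimage_image _ _)
    rintro w ⟨x, hx, hxw⟩
    have := hA x hx _ (QuotientGroup.eq.1 hxw)
    simpa using this
  rw [← hpre, ← Nat.card_coe_set_eq,
    Nat.card_congr (QuotientGroup.preimageMkEquivSubgroupProdSet K _), Nat.card_prod]
  exact dvd_mul_right _ _

/-- A pair `u ∈ ⟨v⟩` of extreme elements in a twin class that contains elements generating
different cyclic subgroups. -/
structure IsExtremePair (u v : G) : Prop where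
  ne_one : u ≠ 1
  mem : u ∈ zpowers v
  notMem : v ∉ zpowers u
  twin : PowTwin u v
  extreme : ∀ w, w ≠ 1 → PowTwin w u → w ∈ zpowers v ∧ u ∈ zpowers w

theorem exists_isExtremePair [Finite G] {u₀ v₀ : G} (hu : u₀ ≠ 1) (hv : v₀ ≠ 1)
    (ht : PowTwin u₀ v₀) (hne : zpowers u₀ ≠ zpowers v₀) :
    ∃ u v : G, PowTwin u u₀ ∧ IsExtremePair u v := by
  let C : Set G := {w | w ≠ 1 ∧ PowTwin w u₀}
  have hC : C.Finite := Set.toFinite C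
  have hu₀ : u₀ ∈ C := ⟨hu, PowTwin.of_zpowers_eq rfl⟩
  have hv₀ : v₀ ∈ C := ⟨hv, ht.symm⟩
  obtain ⟨v, hvC, hvmax⟩ := Set.exists_max_image C orderOf hC ⟨u₀, hu₀⟩
  obtain ⟨u, huC, humin⟩ := Set.exists_min_image C orderOf hC ⟨u₀, hu₀⟩
  have hle : ∀ x ∈ C, ∀ y ∈ C, orderOf x ≤ orderOf y → x ∈ zpowers y := by
    intro x hx y hy hxy
    rcases (hx.2.trans hy.2.symm).1.adj with h | h
    · exact h
    · exact mem_zpowers_of_orderOf_le h hxy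
  refine ⟨u, v, huC.2, huC.1, hle u huC v hvC (humin v hvC), fun hvu => hne ?_,
    huC.2.trans hvC.2.symm, fun w hw hwu => ?_⟩
  · have h1 := Nat.le_of_dvd (orderOf_pos u) (orderOf_dvd_of_mem hvu)
    have := hvmax _ hu₀
    have := hvmax _ hv₀
    have := humin _ hu₀
    have := humin _ hv₀
    exact zpowers_eq_of_mem (hle _ hu₀ _ hv₀ (by omega)) (hle _ hv₀ _ hu₀ (by omega))
  · have hwC : w ∈ C := ⟨hw, hwu.trans huC.2⟩
    exact ⟨hle w hwC v hvC (hvmax w hwC), hle u huC w hwC (humin w hwC)⟩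

namespace IsExtremePair

variable {u v : G}

theorem isPrimePow [Finite G] (h : IsExtremePair u v) {w : G} (hw : u ∈ zpowers w) :
    IsPrimePow (orderOf w) := by
  have hv : IsPrimePow (orderOf v) :=
    isPrimePow_orderOf_of_adj h.ne_one h.mem h.notMem fun w hw => h.twin.1 w (Or.inr hw)
  rcases h.twin.2 w (Or.inl hw) with hvw | hwv
  swap
  · exact hv.dvd (orderOf_dvd_of_mem hwv) (by
      intro h1
      rw [orderOf_eq_one_iff] at h1
      subst h1
      exact h.ne_one (by simpa using hw))
  obtain ⟨q, j, hq, hj, hqj⟩ := (isPrimePow_nat_iff _).1 hv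
  obtain ⟨i, hij, hi⟩ := (Nat.dvd_prime_pow hq).1 (hqj ▸ orderOf_dvd_of_mem h.mem)
  rw [isPrimePow_iff_unique_prime_dvd]
  refine ⟨q, ⟨hq, (dvd_pow_self q hj.ne').trans (hqj ▸ orderOf_dvd_of_mem hvw)⟩, ?_⟩
  rintro r ⟨hr, hrw⟩
  by_contra hrq
  have hcop : (q ^ i).Coprime r := (Nat.coprime_primes hq hr).2 (Ne.symm hrq) |>.pow_left i
  obtain ⟨x, hxw, hx⟩ := exists_mem_zpowers_orderOf_eq w
    (hcop.mul_dvd_of_dvd_of_dvd (hi ▸ orderOf_dvd_of_mem hw) hrw)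
  have hux : u ∈ zpowers x :=
    mem_zpowers_of_orderOf_dvd hw hxw (by rw [hi, hx]; exact dvd_mul_right _ _)
  rcases (h.twin.2 x (Or.inl hux)).orderOf_dvd with h1 | h1
  · rw [hx, ← hqj] at h1
    have h2 : q ^ j ∣ q ^ i :=
      Nat.Coprime.dvd_of_dvd_mul_right
        ((Nat.coprime_primes hq hr).2 (Ne.symm hrq) |>.pow_left j) h1
    exact h.notMem (mem_zpowers_of_orderOf_dvd (mem_zpowers v) h.mem (by rwa [hi, ← hqj]))
  · rw [hx, ← hqj] at h1
    exact hrq ((Nat.prime_dvd_prime_iff_eq hr hq).1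
      (hr.dvd_of_dvd_pow ((dvd_mul_left _ _).trans h1)))

theorem powDom_iff [Finite G] (h : IsExtremePair u v) (y : G) :
    PowDom y u ↔ y ∈ zpowers v := by
  constructor
  · intro hy
    rcases hy v (Or.inl h.mem) with hyv | hvy
    · exact hyv
    have huy : u ∈ zpowers y := mem_zpowers_trans h.mem hvy
    refine (h.extreme y ?_ ⟨hy, fun w hw => ?_⟩).1
    · rintro rfl
      exact h.ne_one (by simpa using huy)
    · rcases hw with hw | hw
      · exact Or.inl (mem_zpowers_trans huy hw)
      · exact powAdj_of_isPrimePow (h.isPrimePow huy) huy hw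
  · intro hy w hw
    rcases h.twin.2 w hw with hvw | hwv
    · exact Or.inl (mem_zpowers_trans hy hvw)
    · exact powAdj_of_isPrimePow (h.isPrimePow h.mem) hy hwv

theorem twin_iff [Finite G] (h : IsExtremePair u v) (w : G) :
    (w ≠ 1 ∧ PowTwin w u) ↔ w ∈ zpowers v ∧ u ∈ zpowers w := by
  refine ⟨fun hw => h.extreme w hw.1 hw.2, fun ⟨hwv, huw⟩ => ⟨?_, (h.powDom_iff w).2 hwv, ?_⟩⟩
  · rintro rfl
    exact h.ne_one (by simpa using huw)
  · intro x hx
    rcases hx with hx | hx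
    · exact Or.inl (mem_zpowers_trans huw hx)
    · exact powAdj_of_isPrimePow (h.isPrimePow h.mem) h.mem (mem_zpowers_trans hx hwv)

theorem ncard_powDom [Finite G] (h : IsExtremePair u v) :
    {y | PowDom y u}.ncard = orderOf v := by
  simp_rw [h.powDom_iff, ← Nat.card_zpowers, ← Nat.card_coe_set_eq]
  rfl

theorem totient_lt [Finite G] (h : IsExtremePair u v) :
    (orderOf v).totient < {w | w ≠ 1 ∧ PowTwin w u}.ncard := by
  simp_rw [h.twin_iff, ← ncard_zpowers_eq]
  refine Set.ncard_lt_ncard ?_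
  rw [Set.ssubset_iff_of_subset]
  · exact ⟨u, ⟨h.mem, mem_zpowers u⟩, fun h1 => h.notMem (h1.symm ▸ mem_zpowers v)⟩
  · rintro w hw
    exact ⟨hw ▸ mem_zpowers w, hw ▸ h.mem⟩

theorem ncard_diff_lt [Finite G] (h : IsExtremePair u v) :
    ({y | PowDom y u} \ {w | w ≠ 1 ∧ PowTwin w u}).ncard <
      {w | w ≠ 1 ∧ PowTwin w u}.ncard := by
  simp_rw [h.twin_iff, h.powDom_iff]
  have h1 : ({y | y ∈ zpowers v} \ {w | w ∈ zpowers v ∧ u ∈ zpowers w} : Set G) ⊂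
      (zpowers u : Set G) := by
    rw [Set.ssubset_iff_of_subset]
    · exact ⟨u, mem_zpowers u, fun h2 => h2.2 ⟨h.mem, mem_zpowers u⟩⟩
    · rintro y ⟨hy, hy'⟩
      rcases powAdj_of_isPrimePow (h.isPrimePow h.mem) hy h.mem with h2 | h2
      · exact h2
      · exact absurd ⟨hy, h2⟩ hy'
  have h2 : (zpowers v : Set G) \ (zpowers u : Set G) ⊆
      {w | w ∈ zpowers v ∧ u ∈ zpowers w} := by
    rintro y ⟨hy, hy'⟩
    exact ⟨hy, (powAdj_of_isPrimePow (h.isPrimePow h.mem) hy h.mem).resolve_left hy'⟩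
  have h3 := Set.ncard_lt_ncard h1
  have h4 := Set.ncard_le_ncard h2
  have h5 : (zpowers u : Set G).ncard = orderOf u := by
    rw [← Nat.card_zpowers, ← Nat.card_coe_set_eq]; rfl
  have h6 : (zpowers v : Set G).ncard = orderOf v := by
    rw [← Nat.card_zpowers, ← Nat.card_coe_set_eq]; rfl
  have h7 := Set.ncard_sdiff_add_ncard_of_subset (SetLike.coe_subset_coe.2 (zpowers_le.2 h.mem))
  obtain ⟨k, hk⟩ := orderOf_dvd_of_mem h.mem
  have hk1 : k ≠ 1 := by
    rintro rfl
    exact h.notMem (mem_zpowers_of_orderOf_le h.mem (by omega))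
  have hk0 : k ≠ 0 := by
    rintro rfl
    exact (orderOf_pos v).ne' (by simpa using hk)
  have : orderOf u * 2 ≤ orderOf v := by
    rw [hk]; exact Nat.mul_le_mul_left _ (by omega)
  omega

theorem orderOf_dvd_ncard_adj [Finite G] (h : IsExtremePair u v) :
    orderOf v ∣ {w | PowAdj u w}.ncard := by
  rw [← Nat.card_zpowers]
  refine card_dvd_ncard_of_mul_mem _ _ fun w hw k hk => h.twin.1 _ ?_
  by_cases hwv : w ∈ zpowers v
  · exact Or.inr (mul_mem hwv hk)
  have hvw : v ∈ zpowers w := (h.twin.2 w hw).resolve_right hwv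
  have hkw := mem_zpowers_trans hk hvw
  refine Or.inl (mem_zpowers_trans hvw ?_)
  have hwk : w * k ∈ zpowers w := mul_mem (mem_zpowers w) hkw
  rcases powAdj_of_isPrimePow (h.isPrimePow (mem_zpowers_trans h.mem hvw)) hwk hkw with h1 | h1
  · exact absurd ((mul_mem_cancel_right hk).1 (mem_zpowers_trans h1 hk)) hwv
  · have := mul_mem (mem_zpowers (w * k)) (inv_mem h1)
    simpa using this

theorem no_four_cycle [Finite G] (h : IsExtremePair u v) {x y w z : G}
    (hux : PowAdj u x) (huy : PowAdj u y) (huw : PowAdj u w) (huz : PowAdj u z)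
    (hxy : ¬ PowAdj x y) (hwz : ¬ PowAdj w z) (hxw : PowAdj x w) (hxz : PowAdj x z)
    (hyw : PowAdj y w) : False := by
  have above : ∀ {s t : G}, PowAdj u s → PowAdj u t → ¬ PowAdj s t →
      IsPrimePow (orderOf s) := by
    intro s t hs ht hst
    refine h.isPrimePow (mem_zpowers_trans h.mem ?_)
    refine (h.twin.2 s hs).resolve_right fun h1 => hst ?_
    exact (h.powDom_iff s).2 h1 t ht
  have px := above hux huy hxy
  have py := above huy hux (fun h => hxy h.symm)
  have pw := above huw huz hwz
  have pz := above huz huw (fun h => hwz h.symm)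
  rcases hxw with h1 | h1
  · rcases hyw with h2 | h2
    · exact hxy (powAdj_of_isPrimePow pw h1 h2)
    · exact hxy (Or.inl (mem_zpowers_trans h1 h2))
  · rcases hxz with h2 | h2
    · exact hwz (Or.inl (mem_zpowers_trans h1 h2))
    · exact hwz (powAdj_of_isPrimePow px h1 h2)

end IsExtremePair

/-- If in one of two finite groups with the same power graph the nontrivial twins generate the
same cyclic subgroup, then this holds in the other group as well. -/
theorem zpowers_eq_of_powTwin_transfer [Finite G] [Finite H] (φ : G ≃ H)
    (hφ : ∀ x y, PowAdj x y ↔ PowAdj (φ x) (φ y)) (h1 : φ 1 = 1)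
    (hG : ∀ x y : G, x ≠ 1 → y ≠ 1 → PowTwin x y → zpowers x = zpowers y)
    (u₀ v₀ : H) (hu₀ : u₀ ≠ 1) (hv₀ : v₀ ≠ 1) (ht : PowTwin u₀ v₀) :
    zpowers u₀ = zpowers v₀ := by
  by_contra hne
  obtain ⟨u, v, -, h⟩ := exists_isExtremePair hu₀ hv₀ ht hne
  obtain ⟨a, rfl⟩ := φ.surjective u
  have ha : a ≠ 1 := by
    rintro rfl
    exact h.ne_one h1
  have hdom : ∀ x y, PowDom x y ↔ PowDom (φ x) (φ y) := by
    intro x y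
    constructor
    · intro hd w hw
      obtain ⟨w, rfl⟩ := φ.surjective w
      exact (hφ _ _).1 (hd w ((hφ _ _).2 hw))
    · intro hd w hw
      exact (hφ _ _).2 (hd _ ((hφ _ _).1 hw))
  have htwin : ∀ w, (φ w ≠ 1 ∧ PowTwin (φ w) (φ a)) ↔ zpowers w = zpowers a := by
    intro w
    rw [PowTwin, ← hdom, ← hdom, ← h1, φ.injective.ne_iff]
    constructor
    · exact fun hw => hG w a hw.1 ha hw.2
    · intro hw
      refine ⟨?_, PowTwin.of_zpowers_eq hw⟩
      rintro rfl
      exact ha (by simpa using hw.symm)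
  have cardpre : ∀ P : H → Prop, {w | P w}.ncard = {w | P (φ w)}.ncard := by
    intro P
    rw [← Set.ncard_image_of_injective _ φ.injective]
    congr 1
    ext w
    constructor
    · intro hw
      exact ⟨φ.symm w, by simpa using hw, by simp⟩
    · rintro ⟨x, hx, rfl⟩
      exact hx
  have hDcard : {y | PowDom y a}.ncard = orderOf v := by
    rw [← h.ncard_powDom, cardpre]
    simp_rw [← hdom]
  have hCcard : {w | w ≠ 1 ∧ PowTwin w (φ a)}.ncard = (orderOf a).totient := by
    rw [cardpre]
    simp_rw [htwin]
    exact ncard_zpowers_eq a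
  have hlt : {y | PowDom y a ∧ ¬ zpowers y = zpowers a}.ncard < (orderOf a).totient := by
    rw [← hCcard]
    refine lt_of_eq_of_lt ?_ h.ncard_diff_lt
    change _ = {w | PowDom w (φ a) ∧ ¬ (w ≠ 1 ∧ PowTwin w (φ a))}.ncard
    rw [cardpre (fun w => PowDom w (φ a) ∧ ¬ (w ≠ 1 ∧ PowTwin w (φ a)))]
    simp_rw [htwin, ← hdom]
  have hmem : ∀ y, PowDom y a → y ∈ zpowers a := by
    intro y hy
    by_contra hya
    have hay : a ∈ zpowers y := hy.adj.resolve_left hya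
    refine absurd hlt (not_lt.2 ?_)
    refine (Nat.le_of_dvd (Nat.totient_pos.2 (orderOf_pos y))
      (Nat.totient_dvd_of_dvd (orderOf_dvd_of_mem hay))).trans ?_
    rw [← ncard_zpowers_eq]
    refine Set.ncard_le_ncard fun w hw => ⟨(PowTwin.of_zpowers_eq hw).1.trans hy, fun hwa => ?_⟩
    exact hya ((hw.symm.trans hwa) ▸ mem_zpowers y)
  by_cases hN : IsPrimePow (orderOf a)
  · have hD : {y | PowDom y a} = (zpowers a : Set G) := by
      refine subset_antisymm hmem fun y hy w hw => ?_
      rcases hw with hw | hw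
      · exact Or.inl (mem_zpowers_trans hy hw)
      · exact powAdj_of_isPrimePow hN hy hw
    have : orderOf a = orderOf v := by
      rw [← hDcard, hD, ← Nat.card_zpowers, ← Nat.card_coe_set_eq]; rfl
    have h2 := h.totient_lt
    rw [hCcard, this] at h2
    exact lt_irrefl _ h2
  · have hD : {y | PowDom y a} = insert 1 {w | zpowers w = zpowers a} := by
      ext y
      constructor
      · intro hy
        by_contra hcon
        have hcon' : y ≠ 1 ∧ zpowers y ≠ zpowers a := by
          simpa [not_or] using hcon
        refine hN (isPrimePow_orderOf_of_adj hcon'.1 (hmem y hy) (fun hay => ?_)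
          fun w hw => hy w (Or.inr hw))
        exact hcon'.2 (zpowers_eq_of_mem (hmem y hy) hay)
      · rintro (rfl | hy)
        · exact fun w _ => Or.inl (one_mem _)
        · exact (PowTwin.of_zpowers_eq hy).1
    have hcard : orderOf v = (orderOf a).totient + 1 := by
      rw [← hDcard, hD, Set.ncard_insert_of_notMem, ncard_zpowers_eq]
      intro h2
      exact ha (by simpa using (show zpowers (1 : G) = zpowers a from h2).symm)
    have hN1 : orderOf a ≠ 1 := by simpa using ha
    have hmax : ∀ w, a ∈ zpowers w → w ∈ zpowers a := by
      intro w haw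
      by_contra hwa
      have hwD : ¬ PowDom w a := fun hd => hwa (hmem w hd)
      simp only [PowDom, not_forall] at hwD
      obtain ⟨z, haz, hwz⟩ := hwD
      have haz' : a ∈ zpowers z :=
        haz.resolve_right fun hz => hwz (Or.inr (mem_zpowers_trans hz haw))
      rw [isPrimePow_iff_unique_prime_dvd] at hN
      have hp := Nat.minFac_prime hN1
      have : ∃ r, r.Prime ∧ r ∣ orderOf a ∧ r ≠ (orderOf a).minFac := by
        by_contra hcon
        push Not at hcon
        exact hN ⟨_, ⟨hp, Nat.minFac_dvd _⟩, fun r hr => hcon r hr.1 hr.2⟩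
      obtain ⟨r, hr, hra, hrp⟩ := this
      obtain ⟨x, hxa, hx⟩ := exists_mem_zpowers_orderOf_eq a (Nat.minFac_dvd (orderOf a))
      obtain ⟨y, hya, hy⟩ := exists_mem_zpowers_orderOf_eq a hra
      refine h.no_four_cycle (x := φ x) (y := φ y) (w := φ w) (z := φ z) ?_ ?_ ?_ ?_ ?_ ?_
        ?_ ?_ ?_ <;> rw [← hφ]
      · exact Or.inr hxa
      · exact Or.inr hya
      · exact Or.inl haw
      · exact haz
      · intro hxy
        rcases hxy.orderOf_dvd with h2 | h2 <;> rw [hx, hy] at h2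
        · exact hrp ((Nat.prime_dvd_prime_iff_eq hp hr).1 h2).symm
        · exact hrp ((Nat.prime_dvd_prime_iff_eq hr hp).1 h2)
      · exact hwz
      · exact Or.inl (mem_zpowers_trans hxa haw)
      · exact Or.inl (mem_zpowers_trans hxa haz')
      · exact Or.inl (mem_zpowers_trans hya haw)
    have hNdvd : orderOf v ∣ orderOf a := by
      have h2 := h.orderOf_dvd_ncard_adj
      rw [cardpre] at h2
      simp_rw [← hφ] at h2
      convert h2
      rw [← Nat.card_zpowers, ← SetLike.coe_sort_coe, Nat.card_coe_set_eq]
      congr 1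
      ext w
      exact ⟨Or.inr, fun hw => hw.elim (hmax w) id⟩
    obtain ⟨q, j, hq, hj, hqj⟩ := (isPrimePow_nat_iff _).1 (h.isPrimePow h.mem)
    obtain ⟨i, hij, hi⟩ := (Nat.dvd_prime_pow hq).1 (hqj ▸ orderOf_dvd_of_mem h.mem)
    have hi0 : i ≠ 0 := by
      rintro rfl
      exact h.ne_one (by simpa using hi)
    have hij' : i ≠ j := by
      rintro rfl
      exact h.notMem (mem_zpowers_of_orderOf_le h.mem (by rw [hi, hqj]))
    have h2 : (q ^ 2).totient ∣ (orderOf a).totient :=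
      Nat.totient_dvd_of_dvd ((pow_dvd_pow q (by omega)).trans (hqj ▸ hNdvd))
    have h3 : q ∣ (orderOf a).totient := by
      refine dvd_trans ?_ h2
      rw [Nat.totient_prime_pow hq (by norm_num)]
      simp
    have h4 : q ∣ (orderOf a).totient + 1 := hcard ▸ hqj ▸ dvd_pow_self q hj.ne'
    exact hq.one_lt.ne' (Nat.dvd_one.1 ((Nat.dvd_add_right h3).1 h4))

theorem mem_zpowers_map [Finite G] [Finite H] (φ : G ≃ H)
    (hφ : ∀ x y, PowAdj x y ↔ PowAdj (φ x) (φ y)) (h1 : φ 1 = 1)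
    (hG : ∀ x y : G, x ≠ 1 → y ≠ 1 → PowTwin x y → zpowers x = zpowers y)
    (hH : ∀ x y : H, x ≠ 1 → y ≠ 1 → PowTwin x y → zpowers x = zpowers y)
    {a b : G} (hba : b ∈ zpowers a) : φ b ∈ zpowers (φ a) := by
  have hne : ∀ {x}, x ≠ 1 → φ x ≠ 1 := fun hx h => hx (φ.injective (h.trans h1.symm))
  have htwin : ∀ x y, PowTwin x y ↔ PowTwin (φ x) (φ y) := by
    have key : ∀ x y, PowDom x y ↔ PowDom (φ x) (φ y) := by
      intro x y
      constructor
      · intro hd w hw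
        obtain ⟨w, rfl⟩ := φ.surjective w
        exact (hφ _ _).1 (hd w ((hφ _ _).2 hw))
      · intro hd w hw
        exact (hφ _ _).2 (hd _ ((hφ _ _).1 hw))
    exact fun x y => and_congr (key x y) (key y x)
  have hz : ∀ {x y}, x ≠ 1 → y ≠ 1 → (zpowers x = zpowers y ↔
      zpowers (φ x) = zpowers (φ y)) := by
    intro x y hx hy
    exact ⟨fun h => hH _ _ (hne hx) (hne hy) ((htwin _ _).1 (.of_zpowers_eq h)),
      fun h => hG _ _ hx hy ((htwin _ _).2 (.of_zpowers_eq h))⟩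
  by_cases hb : b = 1
  · rw [hb, h1]
    exact one_mem _
  have ha : a ≠ 1 := by
    rintro rfl
    exact hb (by simpa using hba)
  have htot : ∀ {x}, x ≠ 1 → (orderOf x).totient = (orderOf (φ x)).totient := by
    intro x hx
    rw [← ncard_zpowers_eq, ← ncard_zpowers_eq, ← Set.ncard_image_of_injective _ φ.injective]
    congr 1
    ext w
    obtain ⟨w, rfl⟩ := φ.surjective w
    rw [φ.injective.mem_set_image]
    by_cases hw : w = 1
    · subst hw
      simp only [Set.mem_ofPred_eq, h1, zpowers_one_eq_bot]
      constructor
      · intro h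
        exact absurd (by simpa using h.symm) hx
      · intro h
        exact absurd (by simpa using h.symm) (hne hx)
    · exact hz hw hx
  by_contra hcon
  have huv : φ a ∈ zpowers (φ b) := ((hφ b a).1 (Or.inl hba)).resolve_left hcon
  have e1 := Nat.totient_dvd_of_dvd (orderOf_dvd_of_mem hba)
  have e2 := Nat.totient_dvd_of_dvd (orderOf_dvd_of_mem huv)
  rw [← htot ha, ← htot hb] at e2
  have e3 := Nat.dvd_antisymm e1 e2
  have hord : orderOf a = 2 * orderOf b := by
    refine ((Nat.eq_or_eq_of_totient_eq_totient (orderOf_dvd_of_mem hba) e3).resolve_left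
      fun h => hcon ?_).symm
    have := (hz hb ha).1 (zpowers_eq_of_mem hba (mem_zpowers_of_orderOf_le hba h.ge))
    exact this ▸ mem_zpowers _
  have hord' : orderOf (φ b) = 2 * orderOf (φ a) := by
    refine ((Nat.eq_or_eq_of_totient_eq_totient (orderOf_dvd_of_mem huv)
      (by rw [← htot ha, ← htot hb, e3])).resolve_left fun h => hcon ?_).symm
    exact mem_zpowers_of_orderOf_le huv h.ge
  have hodd : ∀ n : ℕ, 0 < n → (2 * n).totient = n.totient → Odd n := by
    intro n hn h
    by_contra hev
    rw [Nat.not_odd_iff_even] at hev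
    rw [Nat.totient_two_mul_of_even hev] at h
    have := Nat.totient_pos.2 hn
    omega
  have hbodd := hodd _ (orderOf_pos b) (by rw [← hord, e3])
  have haodd := hodd _ (orderOf_pos (φ a)) (by rw [← hord', ← htot ha, ← htot hb, e3])
  obtain ⟨t, hta, ht⟩ := exists_mem_zpowers_orderOf_eq a (d := 2) ⟨_, hord⟩
  have ht1 : t ≠ 1 := by
    rintro rfl
    simp at ht
  have htb : ¬ PowAdj b t := by
    rintro (h | h)
    · have h2 := orderOf_dvd_of_mem h
      rw [ht] at h2
      rcases (Nat.dvd_prime Nat.prime_two).1 h2 with h3 | h3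
      · exact hb (orderOf_eq_one_iff.1 h3)
      · rw [h3] at hbodd
        exact absurd hbodd (by decide)
    · have h2 := orderOf_dvd_of_mem h
      rw [ht] at h2
      exact (Nat.not_even_iff_odd.2 hbodd) (even_iff_two_dvd.2 h2)
  rcases (hφ a t).1 (Or.inr hta) with h | h
  · have h2 := Nat.totient_dvd_of_dvd (orderOf_dvd_of_mem h)
    rw [← htot ht1, ht, Nat.totient_two, Nat.dvd_one, Nat.totient_eq_one_iff] at h2
    rcases h2 with h3 | h3
    · exact hne ha (orderOf_eq_one_iff.1 h3)
    · rw [h3] at haodd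
      exact absurd haodd (by decide)
  · exact htb ((hφ b t).2 (Or.inr (mem_zpowers_trans h huv)))

end Transfer

section Abelian

variable {G : Type*} [CommGroup G] [Finite G]

theorem powAdj_of_forall_prime_mem {q : ℕ} (hq : q.Prime) {y : G}
    (h : ∀ (r : ℕ) (t : G), r.Prime → orderOf t = r → t ∈ zpowers y)
    (hy : ∀ r : ℕ, r.Prime → r ∣ orderOf y → r = q) (w z : G) : PowAdj w z := by
  have hprime : ∀ w : G, w ≠ 1 → q ∣ orderOf w := by
    intro w hw
    have h1 : orderOf w ≠ 1 := by simpa using hw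
    have hr := Nat.minFac_prime h1
    obtain ⟨t, htw, ht⟩ := exists_mem_zpowers_orderOf_eq w (Nat.minFac_dvd (orderOf w))
    have := orderOf_dvd_of_mem (h _ t hr ht)
    rw [ht] at this
    rw [← hy _ hr this]
    exact Nat.minFac_dvd _
  have hpp : ∀ w : G, ∀ r : ℕ, r.Prime → r ∣ orderOf w → r = q := by
    intro w r hr hrw
    obtain ⟨t, htw, ht⟩ := exists_mem_zpowers_orderOf_eq w hrw
    have := orderOf_dvd_of_mem (h _ t hr ht)
    rw [ht] at this
    exact hy r hr this
  have key : ∀ n : ℕ, ∀ w z : G, orderOf w = n → n ≤ orderOf z → w ∈ zpowers z := by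
    intro n
    induction n using Nat.strong_induction_on with
    | _ n ih =>
      intro w z hwn hnz
      by_cases hw : w = 1
      · rw [hw]; exact one_mem _
      have hz : z ≠ 1 := by
        rintro rfl
        rw [orderOf_one] at hnz
        have := orderOf_pos w
        exact hw (orderOf_eq_one_iff.1 (by omega))
      have hlt : orderOf (w ^ q) < n := by
        rw [orderOf_pow_of_dvd hq.ne_zero (hprime w hw), hwn]
        exact Nat.div_lt_self (hwn ▸ orderOf_pos w) hq.one_lt
      obtain ⟨k, hk⟩ := mem_powers_iff_mem_zpowers.2 (ih _ hlt (w ^ q) z rfl (by omega))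
      change z ^ k = w ^ q at hk
      have hqk : q ∣ k := by
        by_contra hqk
        have hcop : k.Coprime (orderOf z) := by
          refine Nat.Coprime.symm (Nat.coprime_of_dvd fun r hr hrz hrk => ?_)
          exact hqk (hpp z r hr hrz ▸ hrk)
        have h1 : z ∈ zpowers (z ^ k) := mem_zpowers_pow_iff.2 hcop
        rw [hk] at h1
        have := Nat.le_of_dvd (orderOf_pos _) (orderOf_dvd_of_mem h1)
        omega
      obtain ⟨m, rfl⟩ := hqk
      have hs : (w * (z ^ m)⁻¹) ^ q = 1 := by
        rw [mul_pow, inv_pow, ← hk, ← pow_mul, mul_comm m q, mul_inv_cancel]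
      have hsz : w * (z ^ m)⁻¹ ∈ zpowers z := by
        by_cases hs1 : w * (z ^ m)⁻¹ = 1
        · rw [hs1]; exact one_mem _
        · have hso := orderOf_eq_prime_iff (hp := ⟨hq⟩) |>.2 ⟨hs, hs1⟩
          obtain ⟨t, htz, ht⟩ := exists_mem_zpowers_orderOf_eq z (hprime z hz)
          exact mem_zpowers_trans (mem_zpowers_of_orderOf_dvd (h _ _ hq hso) (h _ t hq ht)
            (by rw [hso, ht])) htz
      simpa using mul_mem hsz (pow_mem (mem_zpowers z) m)
  rcases le_total (orderOf w) (orderOf z) with h1 | h1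
  · exact Or.inl (key _ w z rfl h1)
  · exact Or.inr (key _ z w rfl h1)

/-- In a finite abelian group whose power graph is not complete, nontrivial twins generate the
same cyclic subgroup. -/
theorem zpowers_eq_of_powTwin (hG : ¬ ∀ x y : G, PowAdj x y) (x y : G) (hx : x ≠ 1) (hy : y ≠ 1)
    (ht : PowTwin x y) : zpowers x = zpowers y := by
  wlog hxy : x ∈ zpowers y generalizing x y
  · exact (this y x hy hx ht.symm (ht.1.adj.resolve_left hxy)).symm
  by_contra hne
  have hyx : y ∉ zpowers x := fun h => hne (zpowers_eq_of_mem hxy h)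
  obtain ⟨q, j, hq, hj, hqj⟩ := (isPrimePow_nat_iff _).1
    (isPrimePow_orderOf_of_adj hx hxy hyx fun w hw => ht.1 w (Or.inr hw))
  obtain ⟨i, hij, hi⟩ := (Nat.dvd_prime_pow hq).1 (hqj ▸ orderOf_dvd_of_mem hxy)
  refine hG (powAdj_of_forall_prime_mem hq (y := y) (fun r t hr ht' => ?_) fun r hr hry => ?_)
  swap
  · exact (Nat.prime_dvd_prime_iff_eq hr hq).1 (hr.dvd_of_dvd_pow (hqj ▸ hry))
  by_cases hrq : r = q
  · subst hrq
    obtain ⟨n, hn⟩ := mem_powers_iff_mem_zpowers.2 hxy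
    change y ^ n = x at hn
    have hrn : r ∣ n := by
      by_contra hrn
      have hcop : n.Coprime (orderOf y) := by
        rw [← hqj]
        exact ((Nat.Prime.coprime_iff_not_dvd hr).2 hrn).symm.pow_right j
      exact hyx (hn ▸ mem_zpowers_pow_iff.2 hcop)
    obtain ⟨k, rfl⟩ := hrn
    have htr : t ^ r = 1 := ht' ▸ pow_orderOf_eq_one t
    have h1 : x ∈ zpowers (y * t) := by
      rw [← hn]
      refine mem_zpowers_iff.2 ⟨(r * k : ℕ), ?_⟩
      rw [zpow_natCast, mul_pow, pow_mul t, htr, one_pow, mul_one]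
    have h2 : y * t ∈ zpowers y := by
      rcases ht.2 _ (Or.inl h1) with h2 | h2
      · refine mem_zpowers_of_orderOf_le h2 (Nat.le_of_dvd (orderOf_pos y) ?_)
        rw [orderOf_dvd_iff_pow_eq_one, mul_pow, pow_orderOf_eq_one, one_mul, ← hqj]
        obtain ⟨c, hc⟩ := dvd_pow_self r hj.ne'
        rw [hc, pow_mul, htr, one_pow]
      · exact h2
    exact (Subgroup.mul_mem_cancel_left _ (mem_zpowers y)).1 h2
  · have hcop : ∀ k, (q ^ k).Coprime r :=
      fun k => ((Nat.coprime_primes hq hr).2 (Ne.symm hrq)).pow_left k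
    have h1 : x ∈ zpowers (x * t) := by
      have h2 : (x * t) ^ r = x ^ r := by
        rw [mul_pow, ← ht', pow_orderOf_eq_one, mul_one]
      have h3 : x ∈ zpowers (x ^ r) := mem_zpowers_pow_iff.2 (by rw [hi]; exact (hcop i).symm)
      exact mem_zpowers_trans h3 (h2 ▸ pow_mem (mem_zpowers _) r)
    rcases ht.2 _ (Or.inl h1) with h2 | h2
    · exfalso
      have h3 := (orderOf_dvd_of_mem h2).trans (Commute.orderOf_mul_dvd_mul_orderOf (mul_comm x t))
      rw [hi, ht', ← hqj] at h3
      exact hyx (mem_zpowers_of_orderOf_dvd (mem_zpowers y) hxy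
        (by rw [hi, ← hqj]; exact (hcop j).dvd_of_dvd_mul_right h3))
    · exact (Subgroup.mul_mem_cancel_left _ hxy).1 h2

end Abelian

section IndependentSets

variable {G : Type*} [Group G]

theorem independent_singleton_iff {x : G} : Independent {x} ↔ x ≠ 1 := by
  simp [Independent]

theorem independent_pair_iff {x y : G} (h : x ≠ y) : Independent {x, y} ↔ ¬ PowAdj x y := by
  have h1 : ({x, y} \ {x} : Set G) = {y} := by
    ext z; simp only [Set.mem_sdiff, Set.mem_insert_iff, Set.mem_singleton_iff]; grind
  have h2 : ({x, y} \ {y} : Set G) = {x} := by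
    ext z; simp only [Set.mem_sdiff, Set.mem_insert_iff, Set.mem_singleton_iff]; grind
  simp [Independent, h1, h2, PowAdj, zpowers_eq_closure]

theorem Independent.mono {X Y : Set G} (hX : Independent X) (h : Y ⊆ X) : Independent Y :=
  fun y hy hy' => hX y (h hy) (closure_mono (Set.sdiff_subset_sdiff_left h) hy')

theorem exists_independent_subset [Finite G] (X : Set G) :
    ∃ Y ⊆ X, Independent Y ∧ closure Y = closure X := by
  obtain ⟨Y, hY, hmin⟩ := Set.exists_min_image {Y : Set G | Y ⊆ X ∧ closure Y = closure X}
    Set.ncard (Set.toFinite _) ⟨X, subset_rfl, rfl⟩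
  refine ⟨Y, hY.1, fun y hy hyc => ?_, hY.2⟩
  have h1 : closure (Y \ {y}) = closure Y := by
    refine le_antisymm (closure_mono Set.sdiff_subset) ((closure_le _).2 fun z hz => ?_)
    by_cases hzy : z = y
    · exact hzy ▸ hyc
    · exact subset_closure ⟨hz, hzy⟩
  have h2 := hmin (Y \ {y}) ⟨Set.sdiff_subset.trans hY.1, h1.trans hY.2⟩
  have h3 := Set.ncard_sdiff_singleton_lt_of_mem hy
  omega

theorem dgen_closure_le [Finite G] (S : Set G) : dgen (closure S) ≤ S.ncard :=
  Nat.sInf_le ⟨S, Set.toFinite S, subset_closure, rfl, rfl⟩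

theorem exists_closure_eq_ncard_eq_dgen [Finite G] (K : Subgroup G) :
    ∃ S : Set G, closure S = K ∧ S.ncard = dgen K := by
  obtain ⟨S, -, -, h, h'⟩ := Nat.sInf_mem (s := {n : ℕ | ∃ S : Set G, S.Finite ∧
    S ⊆ (K : Set G) ∧ closure S = K ∧ S.ncard = n})
    ⟨_, K, Set.toFinite _, subset_rfl, closure_eq K, rfl⟩
  exact ⟨S, h, h'⟩

theorem StronglyIndependent.independent [Finite G] {X : Set G} (h : StronglyIndependent X) :
    Independent X := by
  obtain ⟨Y, hYX, hY, hcl⟩ := exists_independent_subset X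
  have h1 := h (closure X) subset_closure
  rw [← hcl] at h1
  have h2 : Y = X := Set.eq_of_subset_of_ncard_le hYX (h1.trans (dgen_closure_le Y))
  exact h2 ▸ hY

theorem stronglyIndependent_iff_of_powAdj [Finite G] (hG : ∀ x y : G, PowAdj x y) (X : Set G) :
    StronglyIndependent X ↔ Independent X := by
  refine ⟨StronglyIndependent.independent, fun hX K hXK => ?_⟩
  have hsub : X.Subsingleton := by
    intro x hx y hy
    by_contra hxy
    exact (independent_pair_iff hxy).1
      (hX.mono (by rintro z (rfl | rfl) <;> assumption)) (hG x y)
  rcases hsub.eq_empty_or_singleton with rfl | ⟨x, rfl⟩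
  · simp
  · rw [Set.ncard_singleton, Nat.one_le_iff_ne_zero]
    intro h0
    obtain ⟨S, hS, hSc⟩ := exists_closure_eq_ncard_eq_dgen K
    rw [h0, Set.ncard_eq_zero] at hSc
    rw [hSc, Subgroup.closure_empty] at hS
    subst hS
    exact independent_singleton_iff.1 hX (by simpa using hXK)

theorem map_one_of_independent {H : Type*} [Group H] (φ : G ≃ H)
    (h : ∀ X : Set G, Independent X ↔ Independent (φ '' X)) : φ 1 = 1 := by
  by_contra h1
  have h2 := (h {1}).2 (by rw [Set.image_singleton]; exact independent_singleton_iff.2 h1)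
  exact independent_singleton_iff.1 h2 rfl

theorem powAdj_map_iff_of_independent {H : Type*} [Group H] (φ : G ≃ H)
    (h : ∀ X : Set G, Independent X ↔ Independent (φ '' X)) (x y : G) :
    PowAdj x y ↔ PowAdj (φ x) (φ y) := by
  by_cases hxy : x = y
  · subst hxy
    exact iff_of_true (.refl _) (.refl _)
  · rw [← not_iff_not, ← independent_pair_iff hxy, h, Set.image_pair,
      independent_pair_iff (φ.injective.ne hxy)]

end IndependentSets

section Primary

/-- An exponent which is `1` modulo the `p`-part of `n` and `0` modulo the rest of `n`. -/
def primaryExp (n p : ℕ) : ℕ := ordCompl[p] n ^ Nat.totient (ordProj[p] n)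

theorem primaryExp_modEq_one {n p : ℕ} (hn : n ≠ 0) (hp : p.Prime) :
    primaryExp n p ≡ 1 [MOD ordProj[p] n] :=
  Nat.ModEq.pow_totient ((Nat.coprime_ordCompl hp hn).pow_left _).symm

theorem ordCompl_dvd_primaryExp {n p : ℕ} (hp : p.Prime) : ordCompl[p] n ∣ primaryExp n p :=
  dvd_pow_self _ (Nat.totient_pos.2 (pow_pos hp.pos _)).ne'

variable {G : Type*} [Group G]

/-- The `p`-part of an element of a finite group. -/
noncomputable def primaryPart (p : ℕ) (x : G) : G := x ^ primaryExp (Nat.card G) p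

/-- Elements of `p`-power order in a finite group. -/
def IsPrimary (p : ℕ) (x : G) : Prop := x ^ ordProj[p] (Nat.card G) = 1

theorem primaryPart_mem {K : Subgroup G} {x : G} (p : ℕ) (h : x ∈ K) : primaryPart p x ∈ K :=
  pow_mem h _

variable {p : ℕ}

theorem isPrimary_primaryPart (hp : p.Prime) (x : G) : IsPrimary p (primaryPart p x) := by
  rw [IsPrimary, primaryPart, ← pow_mul, ← orderOf_dvd_iff_pow_eq_one]
  obtain ⟨c, hc⟩ := ordCompl_dvd_primaryExp (n := Nat.card G) hp
  rw [hc, mul_right_comm, mul_comm (ordCompl[p] _), Nat.ordProj_mul_ordCompl_eq_self]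
  exact (orderOf_dvd_natCard x).mul_right _

theorem IsPrimary.primaryPart_eq [Finite G] {x : G} (hp : p.Prime) (h : IsPrimary p x) :
    primaryPart p x = x := by
  have h1 : primaryExp (Nat.card G) p ≡ 1 [MOD orderOf x] :=
    (primaryExp_modEq_one Nat.card_pos.ne' hp).of_dvd (orderOf_dvd_of_pow_eq_one h)
  simpa [primaryPart] using pow_eq_pow_iff_modEq.2 h1

theorem IsPrimary.primaryPart_eq_one {q : ℕ} {x : G} (hp : p.Prime) (hq : q.Prime) (hqp : q ≠ p)
    (h : IsPrimary q x) : primaryPart p x = 1 := by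
  rw [primaryPart, ← orderOf_dvd_iff_pow_eq_one]
  refine (orderOf_dvd_of_pow_eq_one h).trans (dvd_trans ?_ (ordCompl_dvd_primaryExp hp))
  refine Nat.Coprime.dvd_of_dvd_mul_left (m := ordProj[p] (Nat.card G)) ?_ ?_
  · exact Nat.Coprime.pow _ _ ((Nat.coprime_primes hq hp).2 hqp)
  · rw [Nat.ordProj_mul_ordCompl_eq_self]
    exact Nat.ordProj_dvd _ _

theorem isPrimary_iff_orderOf [Finite G] (hp : p.Prime) {x : G} :
    IsPrimary p x ↔ ∃ k, orderOf x = p ^ k := by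
  constructor
  · intro h
    obtain ⟨k, -, hk⟩ := (Nat.dvd_prime_pow hp).1 (orderOf_dvd_of_pow_eq_one h)
    exact ⟨k, hk⟩
  · rintro ⟨k, hk⟩
    rw [IsPrimary, ← orderOf_dvd_iff_pow_eq_one, hk]
    refine pow_dvd_pow _ ((hp.pow_dvd_iff_le_factorization Nat.card_pos.ne').1 ?_)
    exact hk ▸ orderOf_dvd_natCard x

theorem mem_of_forall_primaryPart_mem [Finite G] {K : Subgroup G} {x : G}
    (h : ∀ p ∈ (Nat.card G).primeFactors, primaryPart p x ∈ K) : x ∈ K := by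
  obtain ⟨d, hd⟩ := Int.subgroup_cyclic
    { carrier := {k : ℤ | x ^ k ∈ K}
      zero_mem' := by simp
      add_mem' := fun {a b} ha hb => by
        simp only [Set.mem_ofPred_eq, zpow_add] at *
        exact mul_mem ha hb
      neg_mem' := fun {a} ha => by simpa using ha }
  have hmem : ∀ k : ℤ, x ^ k ∈ K ↔ d ∣ k := by
    intro k
    rw [← Int.mem_zmultiples_iff, AddSubgroup.zmultiples_eq_closure, ← hd]
    rfl
  by_cases h1 : d.natAbs = 1
  · simpa using (hmem 1).2 (Int.natAbs_dvd_natAbs.1 (by simp [h1]))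
  obtain ⟨q, hq, hqd⟩ := Nat.exists_prime_and_dvd h1
  have hqN : q ∣ Nat.card G := hqd.trans (Int.natCast_dvd_natCast.1
    (Int.natAbs_dvd.2 ((hmem _).1 (by simp))))
  have hqm : q ∣ primaryExp (Nat.card G) q := by
    refine hqd.trans (Int.natCast_dvd_natCast.1 (Int.natAbs_dvd.2 ((hmem _).1 ?_)))
    rw [zpow_natCast]
    exact h q (Nat.mem_primeFactors.2 ⟨hq, hqN, Nat.card_pos.ne'⟩)
  have h2 := (primaryExp_modEq_one (Nat.card_pos (α := G)).ne' hq).of_dvd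
    (dvd_pow_self q (hq.factorization_pos_of_dvd Nat.card_pos.ne' hqN).ne')
  exact absurd ((Nat.modEq_zero_iff_dvd.2 hqm).symm.trans h2 |>.symm)
    (fun h3 => hq.one_lt.ne' (Nat.dvd_one.1 (Nat.modEq_zero_iff_dvd.1 h3)))

/-- Taking the `p`-part commutes with multiplication. -/
def PrimaryMul (G : Type*) [Group G] : Prop :=
  ∀ p : ℕ, p.Prime → ∀ x y : G, primaryPart p (x * y) = primaryPart p x * primaryPart p y

theorem primaryMul_of_comm (G : Type*) [CommGroup G] : PrimaryMul G :=
  fun _ _ _ _ => mul_pow _ _ _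

theorem primaryMul_of_normal [Finite G]
    (hn : ∀ {p : ℕ} [Fact p.Prime] (P : Sylow p G), (P : Subgroup G).Normal) : PrimaryMul G := by
  intro p hp x y
  let e := Sylow.directProductOfNormal hn
  obtain ⟨u, rfl⟩ := e.surjective x
  obtain ⟨v, rfl⟩ := e.surjective y
  simp only [primaryPart, ← map_mul, ← map_pow]
  congr 1
  ext q P
  have hq := Nat.prime_of_mem_primeFactors q.2
  have := Fact.mk hq
  have hprim : ∀ z : (P : Subgroup G), IsPrimary q.1 (z : G) := by
    intro z
    rw [isPrimary_iff_orderOf hq]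
    obtain ⟨k, hk⟩ := (IsPGroup.iff_orderOf.1 P.2) z
    exact ⟨k, by rw [← hk, Subgroup.orderOf_coe]⟩
  change primaryPart p ((u * v) q P : G) = primaryPart p (u q P : G) * primaryPart p (v q P : G)
  by_cases hqp : q.1 = p
  · subst hqp
    rw [(hprim _).primaryPart_eq hp, (hprim _).primaryPart_eq hp, (hprim _).primaryPart_eq hp]
    rfl
  · rw [(hprim _).primaryPart_eq_one hp hq hqp, (hprim _).primaryPart_eq_one hp hq hqp,
      (hprim _).primaryPart_eq_one hp hq hqp, one_mul]

theorem IsPrimary.mul [Finite G] (hG : PrimaryMul G) (hp : p.Prime) {x y : G} (hx : IsPrimary p x)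
    (hy : IsPrimary p y) : IsPrimary p (x * y) := by
  have h := isPrimary_primaryPart hp (x * y)
  rwa [hG p hp, hx.primaryPart_eq hp, hy.primaryPart_eq hp] at h

end Primary

section PowIso

variable {G H : Type*} [Group G] [Group H]

/-- A bijection preserving membership in cyclic subgroups. -/
def PowIso (φ : G ≃ H) : Prop := ∀ x y, x ∈ zpowers y ↔ φ x ∈ zpowers (φ y)

theorem PowIso.symm {φ : G ≃ H} (hφ : PowIso φ) : PowIso φ.symm :=
  fun x y => by rw [hφ]; simp

theorem PowIso.map_one {φ : G ≃ H} (hφ : PowIso φ) : φ 1 = 1 := by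
  have h := (hφ 1 (φ.symm 1)).1 (one_mem _)
  simpa using h

theorem PowIso.orderOf_eq {φ : G ≃ H} (hφ : PowIso φ) (x : G) : orderOf (φ x) = orderOf x := by
  rw [← Nat.card_zpowers, ← Nat.card_zpowers]
  refine (Nat.card_congr (φ.subtypeEquiv fun a => ?_)).symm
  exact hφ a x

theorem PowIso.zpowers_map_pow [Finite G] [Finite H] {φ : G ≃ H} (hφ : PowIso φ) (x : G) (m : ℕ) :
    zpowers (φ (x ^ m)) = zpowers (φ x ^ m) := by
  have h1 : φ (x ^ m) ∈ zpowers (φ x) := (hφ _ _).1 (pow_mem (mem_zpowers x) m)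
  have h2 : φ x ^ m ∈ zpowers (φ x) := pow_mem (mem_zpowers _) m
  have h3 : orderOf (φ (x ^ m)) = orderOf (φ x ^ m) := by
    rw [hφ.orderOf_eq, orderOf_pow, orderOf_pow, hφ.orderOf_eq]
  exact zpowers_eq_of_mem (mem_zpowers_of_orderOf_dvd h1 h2 h3.dvd)
    (mem_zpowers_of_orderOf_dvd h2 h1 h3.symm.dvd)

theorem PowIso.isPrimary_iff {φ : G ≃ H} (hφ : PowIso φ) (p : ℕ) {x : G} :
    IsPrimary p (φ x) ↔ IsPrimary p x := by
  rw [IsPrimary, IsPrimary, ← orderOf_dvd_iff_pow_eq_one, ← orderOf_dvd_iff_pow_eq_one,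
    hφ.orderOf_eq, Nat.card_congr φ]

/-- The family of the `f x` with `x ∈ X` is independent. -/
def IndependentOn {G : Type*} (f : G → H) (X : Set G) : Prop := ∀ x ∈ X, f x ∉ closure (f '' (X \ {x}))

theorem IndependentOn.injOn {G : Type*} {f : G → H} {X : Set G} (h : IndependentOn f X) : X.InjOn f := by
  intro x hx y hy hxy
  by_contra hne
  exact h x hx (subset_closure ⟨y, ⟨hy, Ne.symm hne⟩, hxy.symm⟩)

theorem independentOn_iff {G : Type*} {f : G → H} {X : Set G} :
    IndependentOn f X ↔ X.InjOn f ∧ Independent (f '' X) := by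
  have key : X.InjOn f → ∀ x ∈ X, f '' (X \ {x}) = f '' X \ {f x} := fun h x hx => by
    rw [h.image_sdiff_subset (by simpa using hx), Set.image_singleton]
  constructor
  · intro h
    refine ⟨h.injOn, ?_⟩
    rintro _ ⟨x, hx, rfl⟩
    rw [← key h.injOn x hx]
    exact h x hx
  · rintro ⟨h, h'⟩ x hx
    rw [key h x hx]
    exact h' _ ⟨x, hx, rfl⟩

theorem closure_image_le_of_zpowers_eq {α : Type*} {f g : α → G}
    (h : ∀ x, zpowers (f x) = zpowers (g x)) (X : Set α) : closure (f '' X) ≤ closure (g '' X) := by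
  rw [closure_le]
  rintro _ ⟨x, hx, rfl⟩
  have h1 : zpowers (g x) ≤ closure (g '' X) := zpowers_le.2 (subset_closure ⟨x, hx, rfl⟩)
  exact h1 (h x ▸ mem_zpowers _)

theorem closure_image_eq_of_zpowers_eq {α : Type*} {f g : α → G}
    (h : ∀ x, zpowers (f x) = zpowers (g x)) (X : Set α) : closure (f '' X) = closure (g '' X) :=
  le_antisymm (closure_image_le_of_zpowers_eq h X)
    (closure_image_le_of_zpowers_eq (fun x => (h x).symm) X)

theorem independentOn_congr {G : Type*} {f g : G → H} (h : ∀ x, zpowers (f x) = zpowers (g x)) (X : Set G) :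
    IndependentOn f X ↔ IndependentOn g X := by
  simp only [IndependentOn, ← zpowers_le, h, closure_image_eq_of_zpowers_eq h]

theorem independentOn_primaryPart_image [Finite G] [Finite H] {φ : G ≃ H} (hφ : PowIso φ)
    (h : ∀ X : Set G, Independent X ↔ Independent (φ '' X)) (p : ℕ) (X : Set G) :
    IndependentOn (primaryPart p) X ↔ IndependentOn (primaryPart p) (φ '' X) := by
  have h1 : IndependentOn (primaryPart p) X ↔ IndependentOn (φ ∘ primaryPart p) X := by
    rw [independentOn_iff, independentOn_iff, h, Set.image_comp,
      Set.InjOn, Set.InjOn]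
    simp
  have h2 : IndependentOn (φ ∘ primaryPart p) X ↔ IndependentOn (primaryPart p ∘ φ) X := by
    refine independentOn_congr (fun x => ?_) X
    simp only [Function.comp_apply, primaryPart, hφ.zpowers_map_pow, Nat.card_congr φ]
  rw [h1, h2, IndependentOn, IndependentOn, Set.forall_mem_image]
  refine forall₂_congr fun x _ => ?_
  rw [Set.image_comp, Set.image_sdiff φ.injective, Set.image_singleton, Function.comp_apply]

end PowIso

section Transfer

variable {G H : Type*} [CommGroup G] [Finite G] [Group H] [Finite H]

theorem ncard_isPrimary_le {p : ℕ} (hp : p.Prime) :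
    {x : G | IsPrimary p x}.ncard ≤ ordProj[p] (Nat.card G) := by
  set N := ordProj[p] (Nat.card G)
  have hK : IsPGroup p (powMonoidHom N : G →* G).ker := by
    intro x
    exact ⟨(Nat.card G).factorization p, Subtype.ext x.2⟩
  have := Fact.mk hp
  obtain ⟨k, hk⟩ := IsPGroup.iff_card.1 hK
  have h1 : {x : G | IsPrimary p x}.ncard = p ^ k := by
    rw [← hk]; rfl
  rw [h1]
  refine Nat.le_of_dvd (pow_pos hp.pos _) (pow_dvd_pow _ ?_)
  exact (hp.pow_dvd_iff_le_factorization Nat.card_pos.ne').1 (hk ▸ Subgroup.card_subgroup_dvd_card _)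

theorem PowIso.sylow_normal {φ : G ≃ H} (hφ : PowIso φ) {p : ℕ} [hp : Fact p.Prime]
    (P : Sylow p H) : (P : Subgroup H).Normal := by
  have h1 : {x : H | IsPrimary p x} = φ '' {x : G | IsPrimary p x} := by
    ext y
    obtain ⟨x, rfl⟩ := φ.surjective y
    simp [hφ.isPrimary_iff]
  have h2 : ((P : Subgroup H) : Set H) = {x : H | IsPrimary p x} := by
    refine Set.eq_of_subset_of_ncard_le (fun x hx => ?_) ?_
    · rw [Set.mem_ofPred_eq, isPrimary_iff_orderOf hp.out]
      obtain ⟨k, hk⟩ := (IsPGroup.iff_orderOf.1 P.2) ⟨x, hx⟩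
      exact ⟨k, by rw [← hk, Subgroup.orderOf_mk]⟩
    · rw [h1, Set.ncard_image_of_injective _ φ.injective]
      refine (ncard_isPrimary_le hp.out).trans_eq ?_
      rw [Nat.card_congr φ, ← P.card_eq_multiplicity]
      rfl
  refine ⟨fun x hx g => ?_⟩
  have h3 : IsPrimary p x := h2.subset hx
  have h4 : g * x * g⁻¹ ∈ {x : H | IsPrimary p x} := by
    rw [Set.mem_ofPred_eq, IsPrimary, conj_pow, h3, mul_one, mul_inv_cancel]
  rw [← h2] at h4
  exact h4

end Transfer

section StrongIndependence

variable {G : Type*} [Group G]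

/-- The `p`-part as a group homomorphism. -/
noncomputable def primaryHom (hG : PrimaryMul G) {p : ℕ} (hp : p.Prime) : G →* G :=
  MonoidHom.mk' (primaryPart p) (hG p hp)

theorem primaryPart_image_subset_closure (hG : PrimaryMul G) {p : ℕ} (hp : p.Prime) {X S : Set G}
    (h : X ⊆ closure S) : primaryPart p '' X ⊆ closure (primaryPart p '' S) := by
  have h1 := (primaryHom hG hp).map_closure S
  rintro _ ⟨x, hx, rfl⟩
  have h2 : primaryPart p x ∈ (closure S).map (primaryHom hG hp) := ⟨x, h hx, rfl⟩
  rw [h1] at h2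
  exact h2

/-- Independent sets of `p`-elements have size monotone in the subgroup they generate. -/
def PrimaryRankMono (G : Type*) [Group G] : Prop :=
  ∀ p : ℕ, p.Prime → ∀ X Y : Set G, (∀ x ∈ X, IsPrimary p x) → (∀ y ∈ Y, IsPrimary p y) →
    Independent X → Independent Y → X ⊆ closure Y → X.ncard ≤ Y.ncard

theorem stronglyIndependent_of_independentOn [Finite G] (hG : PrimaryMul G) (hr : PrimaryRankMono G)
    {p : ℕ} (hp : p.Prime) {X : Set G} (hX : IndependentOn (primaryPart p) X) :
    StronglyIndependent X := by
  intro K hXK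
  obtain ⟨S, rfl, hSc⟩ := exists_closure_eq_ncard_eq_dgen K
  obtain ⟨Y, hYS, hY, hYc⟩ := exists_independent_subset (primaryPart p '' S)
  have hprim : ∀ Z : Set G, ∀ z ∈ primaryPart p '' Z, IsPrimary p z := by
    rintro Z _ ⟨z, -, rfl⟩
    exact isPrimary_primaryPart hp z
  have h1 := hr p hp (primaryPart p '' X) Y (hprim X) (fun y hy => hprim S y (hYS hy))
    (independentOn_iff.1 hX).2 hY (by rw [hYc]; exact primaryPart_image_subset_closure hG hp hXK)
  rw [hX.injOn.ncard_image] at h1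
  rw [← hSc]
  exact h1.trans ((Set.ncard_le_ncard hYS).trans (Set.ncard_image_le (Set.toFinite S)))

theorem exists_generators_of_not_independentOn [Finite G] {p : ℕ} (hp : p.Prime) {X : Set G} {n : ℕ}
    (hn : X.ncard = n + 1) (hX : ¬ IndependentOn (primaryPart p) X) :
    ∃ g : Fin n → G, (∀ i, IsPrimary p (g i)) ∧
      ∀ x ∈ X, primaryPart p x ∈ closure (Set.range g) := by
  simp only [IndependentOn, not_forall, not_not] at hX
  obtain ⟨x, hx, hxc⟩ := hX
  have h1 : Nat.card (X \ {x} : Set G) = n := by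
    rw [Nat.card_coe_set_eq, Set.ncard_sdiff_singleton_of_mem hx, hn, Nat.add_sub_cancel]
  let e := (Finite.equivFinOfCardEq h1).symm
  have h2 : Set.range (fun i => primaryPart p (e i : G)) = primaryPart p '' (X \ {x}) := by
    ext z
    constructor
    · rintro ⟨i, rfl⟩
      exact ⟨_, (e i).2, rfl⟩
    · rintro ⟨w, hw, rfl⟩
      exact ⟨e.symm ⟨w, hw⟩, by simp⟩
  refine ⟨fun i => primaryPart p (e i : G), fun i => isPrimary_primaryPart hp _, fun w hw => ?_⟩
  rw [h2]
  by_cases hwx : w = x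
  · exact hwx ▸ hxc
  · exact subset_closure ⟨w, ⟨hw, hwx⟩, rfl⟩

theorem StronglyIndependent.exists_independentOn [Finite G] (hG : PrimaryMul G) {X : Set G}
    (hX : StronglyIndependent X) : ∃ p : ℕ, p.Prime ∧ IndependentOn (primaryPart p) X := by
  by_contra hcon
  push Not at hcon
  obtain ⟨n, hn⟩ : ∃ n, X.ncard = n + 1 := by
    refine Nat.exists_eq_succ_of_ne_zero fun h0 => hcon 2 Nat.prime_two ?_
    rw [(Set.ncard_eq_zero (Set.toFinite X)).1 h0]
    exact fun x hx => hx.elim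
  have h1 : ∀ p : ℕ, ∃ g : Fin n → G, p.Prime → (∀ i, IsPrimary p (g i)) ∧
      ∀ x ∈ X, primaryPart p x ∈ closure (Set.range g) := by
    intro p
    by_cases hp : p.Prime
    · obtain ⟨g, hg⟩ := exists_generators_of_not_independentOn hp hn (hcon p hp)
      exact ⟨g, fun _ => hg⟩
    · exact ⟨1, fun h => absurd h hp⟩
  choose f hf using h1
  let y : Fin n → G := fun i => ((Nat.card G).primeFactors.toList.map fun p => f p i).prod
  have hy : ∀ q ∈ (Nat.card G).primeFactors, ∀ i, primaryPart q (y i) = f q i := by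
    intro q hq i
    have hqp := Nat.prime_of_mem_primeFactors hq
    change primaryHom hG hqp _ = _
    rw [map_list_prod, List.map_map, List.prod_map_eq_pow_single q,
      List.count_eq_one_of_mem (Finset.nodup_toList _) (Finset.mem_toList.2 hq), pow_one]
    · exact ((hf q hqp).1 i).primaryPart_eq hqp
    · intro p hpq hp
      have hpp := Nat.prime_of_mem_primeFactors (Finset.mem_toList.1 hp)
      exact ((hf p hpp).1 i).primaryPart_eq_one hqp hpp hpq
  have h2 := hX (closure (Set.range y)) fun x hx => mem_of_forall_primaryPart_mem fun q hq => by
    refine (closure_le _).2 ?_ ((hf q (Nat.prime_of_mem_primeFactors hq)).2 x hx)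
    rintro _ ⟨i, rfl⟩
    rw [← hy q hq i]
    exact primaryPart_mem q (subset_closure ⟨i, rfl⟩)
  have h3 := h2.trans (dgen_closure_le _)
  rw [← Set.image_univ] at h3
  have h4 := h3.trans (Set.ncard_image_le (Set.toFinite _))
  rw [Set.ncard_univ, Nat.card_fin] at h4
  omega

theorem stronglyIndependent_iff [Finite G] (hG : PrimaryMul G) (hr : PrimaryRankMono G) {X : Set G} :
    StronglyIndependent X ↔ ∃ p : ℕ, p.Prime ∧ IndependentOn (primaryPart p) X :=
  ⟨fun h => h.exists_independentOn hG,
    fun ⟨_, hp, h⟩ => stronglyIndependent_of_independentOn hG hr hp h⟩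

end StrongIndependence

section Counting

variable {G : Type*} [Group G]

theorem card_mul_relIndex {K L : Subgroup G} (h : K ≤ L) :
    Nat.card K * K.relIndex L = Nat.card L := by
  rw [← relIndex_bot_left, ← relIndex_bot_left, relIndex_mul_relIndex _ _ _ bot_le h]

theorem card_inf_ker_mul_card_map {H : Type*} [Group H] (f : G →* H) (K : Subgroup G) :
    Nat.card (f.ker ⊓ K : Subgroup G) * Nat.card (K.map f) = Nat.card K := by
  rw [← relIndex_ker, ← inf_relIndex_right, card_mul_relIndex inf_le_right]

theorem card_zpowers_sup {p : ℕ} (hp : p.Prime) {K : Subgroup G} [K.Normal] {y : G} (hy : y ∉ K)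
    (hyp : y ^ p ∈ K) : Nat.card (zpowers y ⊔ K : Subgroup G) = p * Nat.card K := by
  have := Fact.mk hp
  have h1 : Nat.card ((zpowers y).map (QuotientGroup.mk' K)) = p := by
    rw [MonoidHom.map_zpowers, Nat.card_zpowers]
    refine orderOf_eq_prime ?_ ?_
    · rw [← map_pow]
      exact (QuotientGroup.eq_one_iff _).2 hyp
    · exact fun h => hy ((QuotientGroup.eq_one_iff _).1 h)
  rw [← relIndex_ker, QuotientGroup.ker_mk', ← relIndex_sup_right] at h1
  rw [← card_mul_relIndex (le_sup_right : K ≤ zpowers y ⊔ K), h1, mul_comm]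

theorem mem_zpowers_of_prime_of_ne_one [Finite G] {p : ℕ} (hp : p.Prime) {t u : G}
    (ht : orderOf t = p) (hu : u ∈ zpowers t) (hu1 : u ≠ 1) : t ∈ zpowers u := by
  refine mem_zpowers_of_orderOf_le hu ?_
  rcases (Nat.dvd_prime hp).1 (ht ▸ orderOf_dvd_of_mem hu) with h | h
  · exact absurd (orderOf_eq_one_iff.1 h) hu1
  · rw [h, ht]

end Counting

section AbelianRank

variable {G : Type*} [CommGroup G] {p : ℕ}

theorem isPrimary_of_mem_closure {A : Set G} (hA : ∀ x ∈ A, IsPrimary p x) {x : G}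
    (hx : x ∈ closure A) : IsPrimary p x := by
  have h1 : closure A ≤ (powMonoidHom (ordProj[p] (Nat.card G)) : G →* G).ker :=
    (closure_le _).2 hA
  exact h1 hx

theorem le_of_le_sup_map_pow {B C : Subgroup G} (hB : ∀ x ∈ B, IsPrimary p x)
    (h : B ≤ C ⊔ B.map (powMonoidHom p)) : B ≤ C := by
  have h1 : ∀ k : ℕ, ∀ b ∈ B, ∃ c ∈ C, ∃ b' ∈ B, c * b' ^ p ^ k = b := by
    intro k
    induction k with
    | zero => exact fun b hb => ⟨1, one_mem _, b, hb, by simp⟩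
    | succ k ih =>
      intro b hb
      obtain ⟨c, hc, b', hb', rfl⟩ := ih b hb
      obtain ⟨d, hd, _, ⟨b'', hb'', rfl⟩, h2⟩ := Subgroup.mem_sup.1 (h hb')
      refine ⟨c * d ^ p ^ k, mul_mem hc (pow_mem hd _), b'', hb'', ?_⟩
      rw [← h2, mul_pow, powMonoidHom_apply, ← pow_mul, ← pow_succ', mul_assoc]
  intro b hb
  obtain ⟨c, hc, b', hb', h2⟩ := h1 ((Nat.card G).factorization p) b hb
  rw [show b' ^ _ = 1 from hB b' hb', mul_one] at h2
  exact h2 ▸ hc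

theorem card_closure_sup_map_pow [Finite G] (hp : p.Prime) {A : Set G}
    (hA : ∀ x ∈ A, IsPrimary p x) (hi : Independent A) {Y : Set G} (hY : Y ⊆ A) :
    Nat.card (closure Y ⊔ (closure A).map (powMonoidHom p) : Subgroup G) =
      p ^ Y.ncard * Nat.card ((closure A).map (powMonoidHom p : G →* G)) := by
  induction Y, Set.toFinite Y using Set.Finite.induction_on with
  | empty => simp
  | @insert y Y hyY _ ih =>
    have hyA : y ∈ A := hY (Set.mem_insert _ _)
    have hYA : Y ⊆ A := (Set.subset_insert _ _).trans hY
    rw [Set.ncard_insert_of_notMem hyY, pow_succ', mul_assoc, ← ih hYA, ← Set.singleton_union,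
      Subgroup.closure_union, ← zpowers_eq_closure, sup_assoc]
    refine card_zpowers_sup hp (fun h => ?_) ?_
    · refine hi y hyA (le_of_le_sup_map_pow (fun x => isPrimary_of_mem_closure hA) ?_
        (subset_closure hyA))
      rw [closure_le]
      intro x hx
      by_cases hxy : x = y
      · subst hxy
        refine sup_le_sup_right (Subgroup.closure_mono fun z hz => ?_) _ h
        exact ⟨hYA hz, fun hzx => hyY (hzx ▸ hz)⟩
      · exact mem_sup_left (subset_closure ⟨hx, hxy⟩)
    · exact mem_sup_right ⟨y, subset_closure hyA, rfl⟩

theorem ncard_pow_eq_one_closure [Finite G] (hp : p.Prime) {A : Set G}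
    (hA : ∀ x ∈ A, IsPrimary p x) (hi : Independent A) :
    {e : G | e ∈ closure A ∧ e ^ p = 1}.ncard = p ^ A.ncard := by
  have h1 := card_closure_sup_map_pow hp hA hi subset_rfl
  have h2 : (closure A).map (powMonoidHom p) ≤ closure A := by
    rintro _ ⟨b, hb, rfl⟩
    exact pow_mem hb p
  rw [sup_eq_left.2 h2, ← card_inf_ker_mul_card_map (powMonoidHom p : G →* G)] at h1
  rw [← Nat.eq_of_mul_eq_mul_right Nat.card_pos h1, ← Nat.card_coe_set_eq]
  refine Nat.card_congr (Equiv.subtypeEquivRight fun x => ?_)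
  exact and_comm

theorem ncard_le_of_forall_mem_closure [Finite G] (hp : p.Prime) {A B : Set G}
    (hA : ∀ x ∈ A, IsPrimary p x) (hB : ∀ x ∈ B, IsPrimary p x)
    (hiA : Independent A) (hiB : Independent B)
    (h : ∀ e, orderOf e = p → e ∈ closure A → e ∈ closure B) : A.ncard ≤ B.ncard := by
  have := Fact.mk hp
  rw [← Nat.pow_le_pow_iff_right hp.one_lt, ← ncard_pow_eq_one_closure hp hA hiA,
    ← ncard_pow_eq_one_closure hp hB hiB]
  refine Set.ncard_le_ncard (fun e he => ⟨?_, he.2⟩) (Set.toFinite _)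
  by_cases h1 : e = 1
  · exact h1 ▸ one_mem _
  · exact h e (orderOf_eq_prime he.2 h1) he.1

theorem primaryRankMono_of_comm (G : Type*) [CommGroup G] [Finite G] : PrimaryRankMono G :=
  fun _ hp _ _ hX hY hiX hiY h => ncard_le_of_forall_mem_closure hp hX hY hiX hiY
    fun _ _ he => (closure_le _).2 h he

theorem mem_zpowers_zpow_of_isPrimary [Finite G] (hp : p.Prime) {w : G} (hw : IsPrimary p w)
    {n : ℤ} (hn : ¬ (p : ℤ) ∣ n) : w ∈ zpowers (w ^ n) := by
  obtain ⟨k, hk⟩ := (isPrimary_iff_orderOf hp).1 hw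
  rw [mem_zpowers_zpow_iff, hk, Nat.cast_pow, ← Int.isCoprime_iff_gcd_eq_one]
  exact ((Nat.prime_iff_prime_int.1 hp).coprime_iff_not_dvd.2 hn).symm.pow_right

theorem mem_closure_pair_of_not_independent [Finite G] (hp : p.Prime) {a c w : G}
    (ha : IsPrimary p a) (ha1 : a ≠ 1) (hc : orderOf c = p) (hca : c ∉ zpowers a)
    (hw : w ^ p ∈ zpowers (a ^ p))
    (h : w = a ∨ w = c ∨ ¬ Independent {a, c, w}) : w ∈ closure {a, c} := by
  have haC : a ∈ closure {a, c} := subset_closure (by simp)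
  have hcC : c ∈ closure {a, c} := subset_closure (by simp)
  by_cases hwa : w = a
  · exact hwa ▸ haC
  by_cases hwc : w = c
  · exact hwc ▸ hcC
  have h' : ∃ x ∈ ({a, c, w} : Set G), x ∈ closure ({a, c, w} \ {x}) := by
    by_contra hcon
    push Not at hcon
    exact (h.resolve_left hwa).resolve_left hwc hcon
  obtain ⟨k, hk⟩ := mem_zpowers_iff.1 hw
  have hwp : IsPrimary p w := by
    obtain ⟨s, hs⟩ := (isPrimary_iff_orderOf hp).1 ha
    have h1 : orderOf w ∣ p ^ (s + 1) := by
      rw [orderOf_dvd_iff_pow_eq_one, pow_succ', pow_mul, ← hk, ← zpow_natCast, ← zpow_mul,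
        mul_comm k, zpow_mul, zpow_natCast, ← pow_mul, mul_comm p, pow_mul, ← hs,
        pow_orderOf_eq_one, one_pow, one_zpow]
    obtain ⟨j, -, hj⟩ := (Nat.dvd_prime_pow hp).1 h1
    exact (isPrimary_iff_orderOf hp).2 ⟨j, hj⟩
  obtain ⟨x, hx, hxc⟩ := h'
  simp only [Set.mem_insert_iff, Set.mem_singleton_iff] at hx
  rcases hx with rfl | rfl | rfl
  · have h1 : x ∈ closure {c, w} := closure_mono (by grind) hxc
    obtain ⟨m, n, hmn⟩ := mem_closure_pair.1 h1
    by_cases hn : (p : ℤ) ∣ n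
    · exfalso
      obtain ⟨j, rfl⟩ := hn
      have h2 : x ^ (1 - p * k * j) = c ^ m := by
        rw [zpow_sub, zpow_one, zpow_mul, zpow_mul, zpow_natCast, hk, mul_inv_eq_iff_eq_mul,
          ← hmn, zpow_mul, zpow_natCast]
      have h3 : x ∈ zpowers c := by
        refine mem_zpowers_trans (mem_zpowers_zpow_of_isPrimary hp ha (n := 1 - p * k * j) ?_)
          (h2 ▸ zpow_mem (mem_zpowers c) m)
        intro h4
        rw [mul_assoc] at h4
        have h5 := (Int.dvd_iff_dvd_of_dvd_sub (a := (p : ℤ)) (b := 1) (c := p * (k * j)) h4).2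
          (dvd_mul_right _ _)
        exact (Nat.prime_iff_prime_int.1 hp).not_dvd_one h5
      exact hca (mem_zpowers_of_prime_of_ne_one hp hc h3 ha1)
    · refine (zpowers_le.2 ?_) (mem_zpowers_zpow_of_isPrimary hp hwp hn)
      rw [← eq_inv_mul_iff_mul_eq] at hmn
      rw [hmn]
      exact mul_mem (inv_mem (zpow_mem hcC m)) haC
  · have h1 : x ∈ closure {a, w} := closure_mono (by grind) hxc
    obtain ⟨m, n, hmn⟩ := mem_closure_pair.1 h1
    have ht : (w * (a ^ k)⁻¹) ^ p = 1 := by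
      rw [mul_pow, ← hk, inv_pow, ← zpow_natCast, ← zpow_natCast, ← zpow_mul, ← zpow_mul,
        mul_comm k, mul_inv_cancel]
    have h2 : (w * (a ^ k)⁻¹) ^ n = (a ^ (m + k * n))⁻¹ * x := by
      rw [← hmn, mul_zpow, zpow_add, zpow_mul, inv_zpow]
      rw [mul_inv_rev, mul_assoc, inv_mul_cancel_left, mul_comm]
    have h3 : (w * (a ^ k)⁻¹) ^ n ≠ 1 := by
      intro h3
      rw [h2, inv_mul_eq_one] at h3
      exact hca (h3 ▸ zpow_mem (mem_zpowers a) _)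
    have := Fact.mk hp
    have ht1 : w * (a ^ k)⁻¹ ≠ 1 := fun h => h3 (by rw [h, one_zpow])
    have h4 := mem_zpowers_of_prime_of_ne_one hp (orderOf_eq_prime ht ht1)
      (zpow_mem (mem_zpowers _) n) h3
    have h5 : w * (a ^ k)⁻¹ ∈ closure {a, x} := by
      refine zpowers_le.2 ?_ h4
      rw [h2]
      exact mul_mem (inv_mem (zpow_mem haC _)) hcC
    exact (mul_mem_cancel_right (inv_mem (zpow_mem haC k))).1 h5
  · exact closure_mono (by grind) hxc

theorem card_closure_pair_le [Finite G] (a c : G) :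
    Nat.card (closure {a, c}) ≤ orderOf a * orderOf c := by
  rw [Set.insert_eq, Subgroup.closure_union, ← zpowers_eq_closure, ← zpowers_eq_closure,
    ← Nat.card_zpowers, ← Nat.card_zpowers]
  have h := Set.natCard_mul_le (s := (zpowers a : Set G)) (t := zpowers c)
  rw [← Subgroup.mul_normal] at h
  exact h

end AbelianRank

section Insert

variable {G : Type*} [Group G] [Finite G]

theorem zpowers_le_normalizer_closure {e : G} {Y : Set G}
    (h : ∀ y ∈ Y, e * y * e⁻¹ ∈ zpowers y) : zpowers e ≤ normalizer (closure Y : Set G) := by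
  have h1 : (closure Y).map (MulAut.conj e).toMonoidHom ≤ closure Y := by
    rw [MonoidHom.map_closure, closure_le]
    rintro _ ⟨y, hy, rfl⟩
    exact zpowers_le.2 (subset_closure hy) (h y hy)
  have h2 : (closure Y).map (MulAut.conj e).toMonoidHom = closure Y :=
    eq_of_le_of_card_ge h1
      (Nat.card_congr ((closure Y).equivMapOfInjective _ (MulAut.conj e).injective).toEquiv).le
  rw [zpowers_le, mem_normalizer_iff]
  intro z
  have h3 := mem_map_iff_mem (f := (MulAut.conj e).toMonoidHom) (MulAut.conj e).injective
    (K := closure Y) (x := z)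
  rw [h2] at h3
  exact h3.symm

theorem Independent.insert {p : ℕ} (hp : p.Prime) {e : G} (he : orderOf e = p) {X : Set G}
    (hX : Independent X) (hn : ∀ x ∈ X, e * x * e⁻¹ ∈ zpowers x) (heX : e ∉ closure X) :
    Independent (insert e X) := by
  have heX' : e ∉ X := fun h => heX (subset_closure h)
  rintro x (rfl | hx) hxc
  · rw [Set.insert_sdiff_of_mem _ (Set.mem_singleton _), Set.sdiff_singleton_eq_self heX'] at hxc
    exact heX hxc
  · have hxe : e ≠ x := fun h => heX' (h ▸ hx)
    rw [Set.insert_sdiff_of_notMem _ (by simpa using hxe), Set.insert_eq, Subgroup.closure_union,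
      ← zpowers_eq_closure, ← SetLike.mem_coe, coe_mul_of_left_le_normalizer_right _ _
      (zpowers_le_normalizer_closure fun y hy => hn y hy.1)] at hxc
    obtain ⟨u, hu, k, hk, huk⟩ := hxc
    by_cases hu1 : u = 1
    · rw [hu1] at huk
      simp only [one_mul] at huk
      exact hX x hx (huk ▸ hk)
    · refine heX (zpowers_le.2 ?_ (mem_zpowers_of_prime_of_ne_one hp he hu hu1))
      have h1 : u = x * k⁻¹ := eq_mul_inv_of_mul_eq huk
      rw [h1]
      exact mul_mem (subset_closure hx) (inv_mem (Subgroup.closure_mono Set.sdiff_subset hk))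

theorem mem_closure_iff_of_prime {p : ℕ} (hp : p.Prime) {e : G} (he : orderOf e = p) {X : Set G}
    (hX : Independent X) (hn : ∀ x ∈ X, e * x * e⁻¹ ∈ zpowers x) :
    e ∈ closure X ↔ e ∈ X ∨ ¬ Independent (insert e X) := by
  constructor
  · intro h
    by_contra! h1
    refine h1.2 e (Set.mem_insert _ _) ?_
    rwa [Set.insert_sdiff_of_mem _ (Set.mem_singleton _), Set.sdiff_singleton_eq_self h1.1]
  · rintro (h | h)
    · exact subset_closure h
    · by_contra h1
      exact h (hX.insert hp he hn h1)

end Insert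

section PGroup

variable {G : Type*} [Group G] [Finite G] {p : ℕ}

theorem IsPGroup.commute_of_ncard_pow_eq_one_le (hp : p.Prime) (hG : IsPGroup p G) {x e : G}
    (hx : x ^ p = 1) (he : e ^ p = 1) (hc : {w : G | w ^ p = 1}.ncard ≤ p ^ 2) :
    Commute x e := by
  have := Fact.mk hp
  by_cases hx1 : x = 1
  · exact hx1 ▸ Commute.one_left e
  have : Nontrivial G := ⟨x, 1, hx1⟩
  have := hG.center_nontrivial
  obtain ⟨z, hz⟩ := exists_prime_orderOf_dvd_card' (G := center G) p
    ((hG.to_subgroup _).card_eq_or_dvd.resolve_left Finite.one_lt_card.ne')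
  have hzp : orderOf (z : G) = p := by rw [Subgroup.orderOf_coe, hz]
  have hzc : ∀ g : G, Commute (z : G) g := fun g => (mem_center_iff.1 z.2 g).symm
  have hznorm : (zpowers (z : G)).Normal := by
    refine ⟨fun n hn g => ?_⟩
    obtain ⟨k, rfl⟩ := mem_zpowers_iff.1 hn
    rw [((hzc g).zpow_left k).symm.eq, mul_inv_cancel_right]
    exact hn
  by_cases hxz : x ∈ zpowers (z : G)
  · obtain ⟨k, rfl⟩ := mem_zpowers_iff.1 hxz
    exact (hzc e).zpow_left k
  have h1 := card_zpowers_sup hp hxz (by rw [hx]; exact one_mem _)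
  rw [Nat.card_zpowers, hzp, ← sq] at h1
  have hform : ∀ w ∈ zpowers x ⊔ zpowers (z : G), ∃ i j : ℤ, x ^ i * (z : G) ^ j = w := by
    intro w hw
    rw [← SetLike.mem_coe, mul_normal] at hw
    obtain ⟨_, ⟨i, rfl⟩, _, ⟨j, rfl⟩, h⟩ := hw
    exact ⟨i, j, h⟩
  have h2 : ((zpowers x ⊔ zpowers (z : G) : Subgroup G) : Set G) = {w : G | w ^ p = 1} := by
    refine Set.eq_of_subset_of_ncard_le (fun w hw => ?_) ?_
    · obtain ⟨i, j, rfl⟩ := hform w hw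
      have hzp' : (z : G) ^ p = 1 := hzp ▸ pow_orderOf_eq_one _
      rw [Set.mem_ofPred_eq, (((hzc x).symm.zpow_left i).zpow_right j).mul_pow, ← zpow_natCast,
        ← zpow_natCast, ← zpow_mul, ← zpow_mul, mul_comm i, mul_comm j, zpow_mul, zpow_mul,
        zpow_natCast, zpow_natCast, hx, hzp', one_zpow, one_zpow, one_mul]
    · rw [← Nat.card_coe_set_eq ((zpowers x ⊔ zpowers (z : G) : Subgroup G) : Set G)]
      exact hc.trans h1.ge
  obtain ⟨i, j, hij⟩ := hform e (h2.superset he)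
  rw [← hij]
  exact ((Commute.refl x).zpow_right i).mul_right ((hzc x).symm.zpow_right j)

theorem IsPGroup.conj_mem_zpowers (hp : p.Prime) (hG : IsPGroup p G) {x e : G} (hx : x ≠ 1)
    (he : e ^ p = 1) (hn : (zpowers (x ^ p)).Normal)
    (hc : {w : G | w ^ p ∈ zpowers (x ^ p)}.ncard ≤ orderOf x * p) :
    e * x * e⁻¹ ∈ zpowers x := by
  have := Fact.mk hp
  have hpx : p ∣ orderOf x := by
    obtain ⟨k, hk⟩ := IsPGroup.iff_orderOf.1 hG x
    rw [hk]
    refine dvd_pow_self p fun h0 => hx ?_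
    rw [← orderOf_eq_one_iff, hk, h0, pow_zero]
  have hox : orderOf x = orderOf (x ^ p) * p := by
    rw [orderOf_pow_of_dvd hp.ne_zero hpx, Nat.div_mul_cancel hpx]
  set Q := zpowers (x ^ p)
  have h1 : {w : G | w ^ p ∈ Q}.ncard = Nat.card Q * {w : G ⧸ Q | w ^ p = 1}.ncard := by
    rw [← Nat.card_coe_set_eq, ← Nat.card_coe_set_eq, ← Nat.card_prod]
    refine Nat.card_congr (Equiv.trans (Equiv.subtypeEquivRight fun w => ?_)
      (QuotientGroup.preimageMkEquivSubgroupProdSet Q {w : G ⧸ Q | w ^ p = 1}))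
    simp [← QuotientGroup.mk_pow, QuotientGroup.eq_one_iff]
  rw [h1, hox, Nat.card_zpowers, mul_assoc] at hc
  have h2 := IsPGroup.commute_of_ncard_pow_eq_one_le hp (hG.to_quotient Q) (x := (x : G ⧸ Q))
    (e := (e : G ⧸ Q))
    (by rw [← QuotientGroup.mk_pow, QuotientGroup.eq_one_iff]; exact mem_zpowers _) (by rw [← QuotientGroup.mk_pow, he, QuotientGroup.mk_one])
    (by rw [sq]; exact Nat.le_of_mul_le_mul_left hc (orderOf_pos _))
  have h3 : e * x * e⁻¹ * x⁻¹ ∈ Q := by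
    rw [← QuotientGroup.eq_one_iff]
    rw [QuotientGroup.mk_mul, QuotientGroup.mk_mul, QuotientGroup.mk_mul, QuotientGroup.mk_inv,
      QuotientGroup.mk_inv, ← h2.eq, mul_inv_cancel_right, mul_inv_cancel]
  have h4 : Q ≤ zpowers x := zpowers_le.2 (pow_mem (mem_zpowers x) p)
  exact (mul_mem_cancel_right (inv_mem (mem_zpowers x))).1 (h4 h3)

end PGroup

section RankTransfer

variable {G H : Type*} [CommGroup G] [Finite G] [Group H] [Finite H] {φ : G ≃ H} {p : ℕ}

theorem PowIso.mem_closure_pair (hφ : PowIso φ)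
    (h : ∀ X : Set G, Independent X ↔ Independent (φ '' X)) (hp : p.Prime) {x e w : H}
    (hx : IsPrimary p x) (hx1 : x ≠ 1) (he : orderOf e = p) (hex : e ∉ zpowers x)
    (hw : w ∈ closure {x, e}) (hwp : w ^ p ∈ zpowers (x ^ p)) :
    φ.symm w ∈ closure {φ.symm x, φ.symm e} := by
  refine mem_closure_pair_of_not_independent hp ((hφ.symm.isPrimary_iff p).2 hx) ?_
    (by rw [hφ.symm.orderOf_eq, he]) ?_ ?_ ?_
  · rwa [← hφ.symm.map_one, φ.symm.injective.ne_iff]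
  · rwa [← hφ.symm]
  · rw [← zpowers_le, ← hφ.symm.zpowers_map_pow w, ← hφ.symm.zpowers_map_pow x, zpowers_le,
      ← hφ.symm]
    exact hwp
  · rw [φ.symm.injective.eq_iff, φ.symm.injective.eq_iff]
    by_contra! hcon
    obtain ⟨hwx, hwe, hi⟩ := hcon
    rw [h] at hi
    simp only [Set.image_insert_eq, Set.image_singleton, Equiv.apply_symm_apply] at hi
    refine hi w (by simp) (Subgroup.closure_mono ?_ hw)
    grind

theorem PowIso.conj_mem_zpowers (hφ : PowIso φ)
    (h : ∀ X : Set G, Independent X ↔ Independent (φ '' X)) (hp : p.Prime) {x e : H}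
    (hx : IsPrimary p x) (he : orderOf e = p) : e * x * e⁻¹ ∈ zpowers x := by
  have := Fact.mk hp
  have hH : PrimaryMul H := primaryMul_of_normal hφ.sylow_normal
  obtain ⟨k, hk⟩ := (isPrimary_iff_orderOf hp).1 hx
  induction k generalizing x with
  | zero =>
    rw [pow_zero, orderOf_eq_one_iff] at hk
    simp [hk]
  | succ k ih =>
    have hx1 : x ≠ 1 := by
      rintro rfl
      rw [orderOf_one] at hk
      exact (Nat.one_lt_pow k.succ_ne_zero hp.one_lt).ne hk
    by_cases hex : e ∈ zpowers x
    · exact mul_mem (mul_mem hex (mem_zpowers x)) (inv_mem hex)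
    have hxk : orderOf (x ^ p) = p ^ k := by
      rw [orderOf_pow_of_dvd hp.ne_zero (hk ▸ dvd_pow_self p k.succ_ne_zero), hk, pow_succ,
        Nat.mul_div_cancel _ hp.pos]
    have hconj := ih ((isPrimary_iff_orderOf hp).2 ⟨k, hxk⟩) hxk
    have heP : IsPrimary p e := (isPrimary_iff_orderOf hp).2 ⟨1, by rw [he, pow_one]⟩
    have hL : IsPGroup p (closure {x, e}) := by
      refine IsPGroup.iff_orderOf.2 fun g => ?_
      rw [← Subgroup.orderOf_coe, ← isPrimary_iff_orderOf hp]
      refine closure_induction (p := fun g _ => IsPrimary p g) ?_ (one_pow _)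
        (fun _ _ _ _ h1 h2 => h1.mul hH hp h2) (fun g _ hg => ?_) g.2
      · rintro y (rfl | rfl) <;> assumption
      · rw [IsPrimary, inv_pow, hg, inv_one]
    let x' : closure {x, e} := ⟨x, subset_closure (by simp)⟩
    let e' : closure {x, e} := ⟨e, subset_closure (by simp)⟩
    have hmem : ∀ u v : closure {x, e}, u ∈ zpowers v ↔ (u : H) ∈ zpowers (v : H) := by
      intro u v
      simp [mem_zpowers_iff, Subtype.ext_iff]
    have hmain : e' * x' * e'⁻¹ ∈ zpowers x' := by
      refine hL.conj_mem_zpowers hp (fun h0 => hx1 (congrArg Subtype.val h0))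
        (Subtype.ext (he ▸ pow_orderOf_eq_one e)) ?_ ?_
      · have hN : closure {x, e} ≤ normalizer (zpowers (x ^ p) : Set H) := by
          have hsub : ∀ g : H, g * x ^ p * g⁻¹ ∈ zpowers (x ^ p) →
              g ∈ normalizer (zpowers (x ^ p) : Set H) := by
            intro g hg
            rw [← zpowers_le, zpowers_eq_closure (x ^ p)]
            exact zpowers_le_normalizer_closure (by simpa using hg)
          rw [closure_le]
          rintro y (rfl | rfl)
          · refine hsub y ?_
            rw [← pow_succ', pow_succ, mul_inv_cancel_right]
            exact mem_zpowers _
          · exact hsub y hconj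
        refine ⟨fun n hn g => ?_⟩
        rw [hmem] at hn ⊢
        exact (mem_normalizer_iff.1 (hN g.2) n).1 hn
      · have h1 := card_closure_pair_le (φ.symm x) (φ.symm e)
        rw [hφ.symm.orderOf_eq, hφ.symm.orderOf_eq, he] at h1
        rw [show orderOf x' = orderOf x from (Subgroup.orderOf_mk _ _ )]
        refine le_trans ?_ h1
        rw [← Nat.card_coe_set_eq]
        refine Nat.card_le_card_of_injective (fun w => ⟨φ.symm w.1.1,
          hφ.mem_closure_pair h hp hx hx1 he hex w.1.2 ((hmem _ _).1 w.2)⟩) ?_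
        intro u v huv
        exact Subtype.ext (Subtype.ext (φ.symm.injective (congrArg Subtype.val huv)))
    exact (hmem _ _).1 hmain

theorem PowIso.mem_closure_iff (hφ : PowIso φ)
    (h : ∀ X : Set G, Independent X ↔ Independent (φ '' X)) (hp : p.Prime) {A : Set G}
    (hA : ∀ x ∈ A, IsPrimary p x) (hi : Independent A) {c : G} (hc : orderOf c = p) :
    c ∈ closure A ↔ φ c ∈ closure (φ '' A) := by
  rw [mem_closure_iff_of_prime hp hc hi (fun x _ => by
      rw [mul_comm c x, mul_inv_cancel_right]; exact mem_zpowers x),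
    mem_closure_iff_of_prime hp ((hφ.orderOf_eq c).trans hc) ((h A).1 hi), h,
    Set.image_insert_eq, φ.injective.mem_set_image]
  rintro _ ⟨x, hx, rfl⟩
  exact hφ.conj_mem_zpowers h hp ((hφ.isPrimary_iff p).2 (hA x hx)) ((hφ.orderOf_eq c).trans hc)

theorem PowIso.primaryRankMono (hφ : PowIso φ)
    (h : ∀ X : Set G, Independent X ↔ Independent (φ '' X)) : PrimaryRankMono H := by
  intro p hp X Y hX hY hiX hiY hXY
  obtain ⟨A, rfl⟩ := φ.surjective.image_surjective X
  obtain ⟨B, rfl⟩ := φ.surjective.image_surjective Y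
  rw [← h] at hiX hiY
  have hA : ∀ x ∈ A, IsPrimary p x := fun x hx => (hφ.isPrimary_iff p).1 (hX _ ⟨x, hx, rfl⟩)
  have hB : ∀ x ∈ B, IsPrimary p x := fun x hx => (hφ.isPrimary_iff p).1 (hY _ ⟨x, hx, rfl⟩)
  rw [Set.ncard_image_of_injective _ φ.injective, Set.ncard_image_of_injective _ φ.injective]
  refine ncard_le_of_forall_mem_closure hp hA hB hiX hiY fun e he heA => ?_
  rw [hφ.mem_closure_iff h hp hA hiX he] at heA
  exact (hφ.mem_closure_iff h hp hB hiY he).2 ((closure_le _).2 hXY heA)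

end RankTransfer

section Main

variable {G H : Type*} [CommGroup G] [Finite G] [Group H] [Finite H] {φ : G ≃ H}

theorem powIso_of_independent (hG : ¬ ∀ x y : G, PowAdj x y)
    (h : ∀ X : Set G, Independent X ↔ Independent (φ '' X)) : PowIso φ := by
  have hadj := powAdj_map_iff_of_independent φ h
  have h1 := map_one_of_independent φ h
  have hadj' : ∀ x y, PowAdj x y ↔ PowAdj (φ.symm x) (φ.symm y) := fun x y => by
    rw [hadj]; simp
  have h1' : φ.symm 1 = 1 := by rw [Equiv.symm_apply_eq, h1]
  have tG := zpowers_eq_of_powTwin hG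
  have tH := zpowers_eq_of_powTwin_transfer φ hadj h1 tG
  intro x y
  refine ⟨mem_zpowers_map φ hadj h1 tG tH, fun hxy => ?_⟩
  simpa using mem_zpowers_map φ.symm hadj' h1' tH tG hxy

theorem stronglyIndependent_image_iff
    (h : ∀ X : Set G, Independent X ↔ Independent (φ '' X)) (X : Set G) :
    StronglyIndependent X ↔ StronglyIndependent (φ '' X) := by
  by_cases hG : ∀ x y : G, PowAdj x y
  · have hH : ∀ x y : H, PowAdj x y := fun x y => by
      have h1 := (powAdj_map_iff_of_independent φ h _ _).1 (hG (φ.symm x) (φ.symm y))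
      simpa using h1
    rw [stronglyIndependent_iff_of_powAdj hG, stronglyIndependent_iff_of_powAdj hH, h]
  · have hφ := powIso_of_independent hG h
    rw [stronglyIndependent_iff (primaryMul_of_comm G) (primaryRankMono_of_comm G),
      stronglyIndependent_iff (primaryMul_of_normal hφ.sylow_normal) (hφ.primaryRankMono h)]
    exact exists_congr fun p => and_congr_right fun _ =>
      independentOn_primaryPart_image hφ h p X

end Main

theorem abelian_indep_iso_implies_strong_indep_iso
    (G₁ G₂ : Type) [CommGroup G₁] [Finite G₁] [Group G₂] [Finite G₂]
    (h : ∃ φ : G₁ ≃ G₂, ∀ X : Set G₁, Independent X ↔ Independent (φ '' X)) :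
    ∃ φ : G₁ ≃ G₂, ∀ X : Set G₁,
      StronglyIndependent X ↔ StronglyIndependent (φ '' X) := by
  obtain ⟨φ, hφ⟩ := h
  exact ⟨φ, stronglyIndependent_image_iff hφ⟩
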